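/- (Bonnet-type theorem, third type) Let K, ϰ : D → ℝ be smooth functions on an open set D ⊆ ℝ² with K² − ϰ² < 0 on D, satisfying the system of natural equations |K² − ϰ²|^{1/4}·Δ^h(ln|K² − ϰ²|) = −8K and |K² − ϰ²|^{1/4}·Δ^h(ln|(K + ϰ)/(K − ϰ)|) = −4ϰ. Then for every t₀ ∈ D there exist an open neighborhood D₀ ⊆ D of t₀ and a smooth minimal time-like surface x : D₀ → ℝ⁴ in canonical coordinates with parameters (ε₀,ε₁) = (0,1) whose Gauss curvature and normal curvature coincide with the given K and ϰ on D₀. Moreover, if x̂ is another such surface defined on a neighborhood of t₀, then there exist a neighborhood D̃₀ of t₀, a linear map A : ℝ⁴ → ℝ⁴ with ⟨Av,Aw⟩ = ⟨v,w⟩ for all v,w and det A = 1, and c ∈ ℝ⁴, such that x̂ = A∘x + c on D̃₀. -/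

import Mathlib

noncomputable section

abbrev V4 : Type := Fin 4 → ℝ

/-- The indefinite scalar product of `ℝ⁴₂`. -/
def ip (a b : V4) : ℝ := -(a 0 * b 0) + a 1 * b 1 - a 2 * b 2 + a 3 * b 3

/-- Partial derivative w.r.t. the first variable. -/
def pu {E : Type*} [NormedAddCommGroup E] [NormedSpace ℝ E]
    (f : ℝ × ℝ → E) (p : ℝ × ℝ) : E := fderiv ℝ f p (1, 0)

/-- Partial derivative w.r.t. the second variable. -/
def pv {E : Type*} [NormedAddCommGroup E] [NormedSpace ℝ E]
    (f : ℝ × ℝ → E) (p : ℝ × ℝ) : E := fderiv ℝ f p (0, 1)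

/-- `E`, the first coefficient of the first fundamental form. -/
def Ef (x : ℝ × ℝ → V4) (p : ℝ × ℝ) : ℝ := ip (pu x p) (pu x p)

/-- Normal projection of a vector `w` at the point `p` of the surface `x`:
`w^⊥ = w − (⟨w,x_u⟩/E)·x_u + (⟨w,x_v⟩/E)·x_v`. -/
def nproj (x : ℝ × ℝ → V4) (w : V4) (p : ℝ × ℝ) : V4 :=
  w - (ip w (pu x p) / Ef x p) • pu x p + (ip w (pv x p) / Ef x p) • pv x p

/-- `a = (x_uu)^⊥`. -/
def sffA (x : ℝ × ℝ → V4) (p : ℝ × ℝ) : V4 := nproj x (pu (pu x) p) p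

/-- `b = (x_uv)^⊥`. -/
def sffB (x : ℝ × ℝ → V4) (p : ℝ × ℝ) : V4 := nproj x (pv (pu x) p) p

/-- Determinant of the 4×4 matrix with columns `v1, v2, v3, v4`. -/
def det4 (v1 v2 v3 v4 : V4) : ℝ := (Matrix.of ![v1, v2, v3, v4]).transpose.det

/-- The Gauss curvature `K = (⟨b,b⟩ − ⟨a,a⟩)/E²`. -/
def GaussK (x : ℝ × ℝ → V4) (p : ℝ × ℝ) : ℝ :=
  (ip (sffB x p) (sffB x p) - ip (sffA x p) (sffA x p)) / (Ef x p) ^ 2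

/-- The curvature of the normal connection `ϰ = −2·det[x_u,x_v,a,b]/E³`. -/
def NormK (x : ℝ × ℝ → V4) (p : ℝ × ℝ) : ℝ :=
  -2 * det4 (pu x p) (pv x p) (sffA x p) (sffB x p) / (Ef x p) ^ 3

/-- The hyperbolic Laplacian `Δʰ f = f_uu − f_vv`. -/
def hlap (f : ℝ × ℝ → ℝ) (p : ℝ × ℝ) : ℝ := pu (pu f) p - pv (pv f) p

/-- Time-like surface in isothermal coordinates with `E < 0`. -/
def IsTimelikeIso (D : Set (ℝ × ℝ)) (x : ℝ × ℝ → V4) : Prop :=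
  ∀ p ∈ D, Ef x p < 0 ∧ ip (pv x p) (pv x p) = -(Ef x p) ∧ ip (pu x p) (pv x p) = 0

/-- Minimality: `x_uu − x_vv = 0`. -/
def IsMinimal (D : Set (ℝ × ℝ)) (x : ℝ × ℝ → V4) : Prop :=
  ∀ p ∈ D, pu (pu x) p - pv (pv x) p = 0

/-- Degenerate point: `(⟨a,a⟩+⟨b,b⟩)² = 4⟨a,b⟩²`. -/
def DegeneratePt (x : ℝ × ℝ → V4) (p : ℝ × ℝ) : Prop :=
  (ip (sffA x p) (sffA x p) + ip (sffB x p) (sffB x p)) ^ 2 =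
    4 * (ip (sffA x p) (sffB x p)) ^ 2

/-- Surface of the first type. -/
def FirstType (D : Set (ℝ × ℝ)) (x : ℝ × ℝ → V4) : Prop :=
  ∀ p ∈ D,
    (ip (sffA x p) (sffA x p) + ip (sffB x p) (sffB x p)) ^ 2 -
      4 * (ip (sffA x p) (sffB x p)) ^ 2 > 0 ∧
    ip (sffA x p) (sffA x p) + ip (sffB x p) (sffB x p) > 0

/-- Surface of the second type. -/
def SecondType (D : Set (ℝ × ℝ)) (x : ℝ × ℝ → V4) : Prop :=
  ∀ p ∈ D,
    (ip (sffA x p) (sffA x p) + ip (sffB x p) (sffB x p)) ^ 2 -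
      4 * (ip (sffA x p) (sffB x p)) ^ 2 > 0 ∧
    ip (sffA x p) (sffA x p) + ip (sffB x p) (sffB x p) < 0

/-- Surface of the third type. -/
def ThirdType (D : Set (ℝ × ℝ)) (x : ℝ × ℝ → V4) : Prop :=
  ∀ p ∈ D,
    (ip (sffA x p) (sffA x p) + ip (sffB x p) (sffB x p)) ^ 2 -
      4 * (ip (sffA x p) (sffB x p)) ^ 2 < 0

/-- Canonical coordinates with parameters `(e0, e1)`:
`⟨a,a⟩+⟨b,b⟩ = e0` and `2⟨a,b⟩ = e1` identically. -/
def Canonical (D : Set (ℝ × ℝ)) (x : ℝ × ℝ → V4) (e0 e1 : ℝ) : Prop :=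
  ∀ p ∈ D,
    ip (sffA x p) (sffA x p) + ip (sffB x p) (sffB x p) = e0 ∧
    2 * ip (sffA x p) (sffB x p) = e1

/-- A minimal time-like surface in canonical coordinates with parameters (0, 1). -/
def GoodSurf (D₀ : Set (ℝ × ℝ)) (x : ℝ × ℝ → V4) : Prop :=
  ContDiffOn ℝ (⊤ : ℕ∞) x D₀ ∧ IsTimelikeIso D₀ x ∧ IsMinimal D₀ x ∧
    Canonical D₀ x (0) (1)

open Set Metric

section Calculus

variable {E : Type*} [NormedAddCommGroup E] [NormedSpace ℝ E] {U : Set (ℝ × ℝ)}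

theorem ContDiffOn.pu {f : ℝ × ℝ → E} (hf : ContDiffOn ℝ (⊤ : ℕ∞) f U) (hU : IsOpen U) :
    ContDiffOn ℝ (⊤ : ℕ∞) (pu f) U :=
  (hf.fderiv_of_isOpen hU (by simp)).clm_apply contDiffOn_const

theorem ContDiffOn.pv {f : ℝ × ℝ → E} (hf : ContDiffOn ℝ (⊤ : ℕ∞) f U) (hU : IsOpen U) :
    ContDiffOn ℝ (⊤ : ℕ∞) (pv f) U :=
  (hf.fderiv_of_isOpen hU (by simp)).clm_apply contDiffOn_const

theorem ContDiffOn.differentiableAt_of_isOpen {F : Type*} [NormedAddCommGroup F]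
    [NormedSpace ℝ F] {f : F → E} {V : Set F}
    (hf : ContDiffOn ℝ (⊤ : ℕ∞) f V) (hV : IsOpen V) {p : F} (hp : p ∈ V) :
    DifferentiableAt ℝ f p :=
  (hf.contDiffAt (hV.mem_nhds hp)).differentiableAt (by simp)

/-- Mixed partial derivatives of a smooth function agree. -/
theorem pu_pv_eq_pv_pu {f : ℝ × ℝ → E} (hf : ContDiffOn ℝ (⊤ : ℕ∞) f U) (hU : IsOpen U)
    {p : ℝ × ℝ} (hp : p ∈ U) : pu (pv f) p = pv (pu f) p := by
  have hd : DifferentiableAt ℝ (fderiv ℝ f) p :=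
    (hf.fderiv_of_isOpen hU (m := (⊤ : ℕ∞)) (by simp)).differentiableAt_of_isOpen hU hp
  have hs : IsSymmSndFDerivAt ℝ f p :=
    (hf.contDiffAt (hU.mem_nhds hp)).isSymmSndFDerivAt
      (by simpa using WithTop.coe_le_coe.2 (le_top : (2 : ℕ∞) ≤ ⊤))
  have key : ∀ w z : ℝ × ℝ, fderiv ℝ (fun q => fderiv ℝ f q w) p z = fderiv ℝ (fderiv ℝ f) p z w := by
    intro w z
    rw [fderiv_clm_apply hd (differentiableAt_const _)]
    simp
  change fderiv ℝ (fun q => fderiv ℝ f q (0, 1)) p (1, 0) =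
    fderiv ℝ (fun q => fderiv ℝ f q (1, 0)) p (0, 1)
  rw [key, key]
  exact hs _ _

theorem pu_congr {f g : ℝ × ℝ → E} (hU : IsOpen U) (h : ∀ q ∈ U, f q = g q) {p : ℝ × ℝ}
    (hp : p ∈ U) : pu f p = pu g p := by
  have : f =ᶠ[nhds p] g := Filter.eventuallyEq_of_mem (hU.mem_nhds hp) h
  simp only [pu, this.fderiv_eq]

theorem pv_congr {f g : ℝ × ℝ → E} (hU : IsOpen U) (h : ∀ q ∈ U, f q = g q) {p : ℝ × ℝ}
    (hp : p ∈ U) : pv f p = pv g p := by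
  have : f =ᶠ[nhds p] g := Filter.eventuallyEq_of_mem (hU.mem_nhds hp) h
  simp only [pv, this.fderiv_eq]

theorem hasDerivAt_slice_fst {f : ℝ × ℝ → E} {s t : ℝ} (hf : DifferentiableAt ℝ f (s, t)) :
    HasDerivAt (fun s' => f (s', t)) (pu f (s, t)) s :=
  HasFDerivAt.comp_hasDerivAt (f := fun s' : ℝ => (s', t)) s hf.hasFDerivAt
    ((hasDerivAt_id s).prodMk (hasDerivAt_const s t))

theorem hasDerivAt_slice_snd {f : ℝ × ℝ → E} {s t : ℝ} (hf : DifferentiableAt ℝ f (s, t)) :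
    HasDerivAt (fun t' => f (s, t')) (pv f (s, t)) t :=
  HasFDerivAt.comp_hasDerivAt (f := fun t' : ℝ => (s, t')) t hf.hasFDerivAt
    ((hasDerivAt_const t s).prodMk (hasDerivAt_id t))

/-- A function whose two partial derivatives vanish on an open preconnected set is constant. -/
theorem eq_of_pu_pv_eq_zero {f : ℝ × ℝ → E} (hU : IsOpen U) (hc : IsPreconnected U)
    (hf : ∀ p ∈ U, DifferentiableAt ℝ f p) (hu : ∀ p ∈ U, pu f p = 0)
    (hv : ∀ p ∈ U, pv f p = 0) {p q : ℝ × ℝ} (hp : p ∈ U) (hq : q ∈ U) : f p = f q := by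
  refine hU.is_const_of_fderiv_eq_zero (𝕜 := ℝ) hc
    (fun p hp => (hf p hp).differentiableWithinAt) (fun p hp => ?_) hp hq
  ext
  · simpa [pu] using hu p hp
  · simpa [pv] using hv p hp

theorem eq_of_hasDerivAt_zero_on_ball {f : ℝ → ℝ} {c r : ℝ}
    (hf : ∀ s ∈ ball c r, HasDerivAt f 0 s) {s s' : ℝ} (hs : s ∈ ball c r) (hs' : s' ∈ ball c r) :
    f s = f s' :=
  isOpen_ball.is_const_of_deriv_eq_zero (𝕜 := ℝ) (convex_ball c r).isPreconnected
    (fun x hx => (hf x hx).differentiableAt.differentiableWithinAt)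
    (fun x hx => (hf x hx).deriv) hs hs'

end Calculus

/-- Local solution of the Liouville equation `ℓ_st = c e^{-2ℓ}`: the function `e^ℓ` is the
symplectic pairing of two plane curves with constant Wronskians. -/
theorem exists_curves_of_liouville {s₀ t₀ r a b c : ℝ} (hr : 0 < r) {l : ℝ × ℝ → ℝ}
    (hl : ContDiffOn ℝ (⊤ : ℕ∞) l (ball s₀ r ×ˢ ball t₀ r))
    (hL : ∀ p ∈ ball s₀ r ×ˢ ball t₀ r, pv (pu l) p = c * Real.exp (-2 * l p))
    (hc : c ≠ 0) (hab : a * b = c) :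
    ∃ p₁ p₂ q₁ q₂ : ℝ → ℝ,
      ContDiffOn ℝ (⊤ : ℕ∞) p₁ (ball s₀ r) ∧ ContDiffOn ℝ (⊤ : ℕ∞) p₂ (ball s₀ r) ∧
      ContDiffOn ℝ (⊤ : ℕ∞) q₁ (ball t₀ r) ∧ ContDiffOn ℝ (⊤ : ℕ∞) q₂ (ball t₀ r) ∧
      (∀ s ∈ ball s₀ r, p₁ s * deriv p₂ s - p₂ s * deriv p₁ s = a) ∧
      (∀ t ∈ ball t₀ r, q₁ t * deriv q₂ t - q₂ t * deriv q₁ t = b) ∧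
      ∀ s ∈ ball s₀ r, ∀ t ∈ ball t₀ r, Real.exp (l (s, t)) = p₁ s * q₂ t - p₂ s * q₁ t := by
  have ha : a ≠ 0 := by rintro rfl; simp at hab; exact hc hab.symm
  have hU : IsOpen (ball s₀ r ×ˢ ball t₀ r) := isOpen_ball.prod isOpen_ball
  have hs₀ : s₀ ∈ ball s₀ r := mem_ball_self hr
  have ht₀ : t₀ ∈ ball t₀ r := mem_ball_self hr
  have hlu := hl.pu hU
  have hlv := hl.pv hU
  have hluu := hlu.pu hU
  have D {f : ℝ × ℝ → ℝ} (hf : ContDiffOn ℝ (⊤ : ℕ∞) f (ball s₀ r ×ˢ ball t₀ r))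
      {s t : ℝ} (hs : s ∈ ball s₀ r) (ht : t ∈ ball t₀ r) : DifferentiableAt ℝ f (s, t) :=
    hf.differentiableAt_of_isOpen hU ⟨hs, ht⟩
  set F : ℝ → ℝ → ℝ := fun s t => Real.exp (l (s, t)) with hF
  have hFpos : ∀ s t, 0 < F s t := fun s t => Real.exp_pos _
  have hFinv : ∀ s t, Real.exp (-2 * l (s, t)) = (F s t ^ 2)⁻¹ := by
    intro s t
    rw [hF, ← Real.exp_nat_mul, ← Real.exp_neg]
    congr 1; push_cast; ring
  have hFs : ∀ s ∈ ball s₀ r, ∀ t ∈ ball t₀ r,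
      HasDerivAt (fun s => F s t) (F s t * pu l (s, t)) s := fun s hs t ht =>
    (hasDerivAt_slice_fst (D hl hs ht)).exp
  have hFt : ∀ s ∈ ball s₀ r, ∀ t ∈ ball t₀ r,
      HasDerivAt (fun t => F s t) (F s t * pv l (s, t)) t := fun s hs t ht =>
    (hasDerivAt_slice_snd (D hl hs ht)).exp
  have hut : ∀ s ∈ ball s₀ r, ∀ t ∈ ball t₀ r,
      HasDerivAt (fun t => pu l (s, t)) (c * (F s t ^ 2)⁻¹) t := by
    intro s hs t ht
    have := hasDerivAt_slice_snd (D hlu hs ht)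
    rwa [hL _ ⟨hs, ht⟩, hFinv] at this
  have hvs : ∀ s ∈ ball s₀ r, ∀ t ∈ ball t₀ r,
      HasDerivAt (fun s => pv l (s, t)) (c * (F s t ^ 2)⁻¹) s := by
    intro s hs t ht
    have := hasDerivAt_slice_fst (D hlv hs ht)
    rwa [pu_pv_eq_pv_pu hl hU ⟨hs, ht⟩, hL _ ⟨hs, ht⟩, hFinv] at this
  have huut : ∀ s ∈ ball s₀ r, ∀ t ∈ ball t₀ r,
      HasDerivAt (fun t => pu (pu l) (s, t)) (-2 * c * pu l (s, t) * (F s t ^ 2)⁻¹) t := by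
    intro s hs t ht
    have h1 := hasDerivAt_slice_snd (D hluu hs ht)
    have h2 : pv (pu (pu l)) (s, t) = -2 * c * pu l (s, t) * (F s t ^ 2)⁻¹ := by
      rw [← pu_pv_eq_pv_pu hlu hU ⟨hs, ht⟩, pu_congr hU hL ⟨hs, ht⟩]
      have h3 : HasDerivAt (fun s => c * Real.exp (-2 * l (s, t)))
          (c * (Real.exp (-2 * l (s, t)) * (-2 * pu l (s, t)))) s :=
        (((hasDerivAt_slice_fst (D hl hs ht)).const_mul (-2)).exp).const_mul c
      have h4 : HasDerivAt (fun s => c * Real.exp (-2 * l (s, t))) _ s :=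
        hasDerivAt_slice_fst (f := fun p => c * Real.exp (-2 * l p))
          (((D hl hs ht).const_mul (-2)).exp.const_mul c)
      rw [h4.unique h3, hFinv]
      ring
    rwa [h2] at h1
  have hm : ∀ s ∈ ball s₀ r, ∀ t ∈ ball t₀ r,
      pu (pu l) (s, t) + pu l (s, t) ^ 2 = pu (pu l) (s, t₀) + pu l (s, t₀) ^ 2 := by
    intro s hs t ht
    refine eq_of_hasDerivAt_zero_on_ball (f := fun t => pu (pu l) (s, t) + pu l (s, t) ^ 2)
      (fun t ht => ?_) ht ht₀
    refine HasDerivAt.congr_deriv ((huut s hs t ht).add ((hut s hs t ht).pow 2)) ?_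
    simp; ring
  set p₁ : ℝ → ℝ := fun s => F s t₀ with hp₁
  set p₁' : ℝ → ℝ := fun s => F s t₀ * pu l (s, t₀) with hp₁'
  set p₂ : ℝ → ℝ := fun s => a / c * (F s t₀ * pv l (s, t₀)) with hp₂
  set p₂' : ℝ → ℝ := fun s =>
    a / c * (F s t₀ * pu l (s, t₀) * pv l (s, t₀) + c * (F s t₀)⁻¹) with hp₂'
  set m : ℝ → ℝ := fun s => pu (pu l) (s, t₀) + pu l (s, t₀) ^ 2 with hmdef
  have dp₁ : ∀ s ∈ ball s₀ r, HasDerivAt p₁ (p₁' s) s := fun s hs => hFs s hs t₀ ht₀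
  have dp₁' : ∀ s ∈ ball s₀ r, HasDerivAt p₁' (m s * p₁ s) s := by
    intro s hs
    refine HasDerivAt.congr_deriv ((hFs s hs t₀ ht₀).mul (hasDerivAt_slice_fst (D hlu hs ht₀))) ?_
    simp only [hmdef, hp₁]; ring
  have dp₂ : ∀ s ∈ ball s₀ r, HasDerivAt p₂ (p₂' s) s := by
    intro s hs
    refine HasDerivAt.congr_deriv (((hFs s hs t₀ ht₀).mul (hvs s hs t₀ ht₀)).const_mul (a / c)) ?_
    have := (hFpos s t₀).ne'
    simp only [hp₂']; field_simp
  have dp₂' : ∀ s ∈ ball s₀ r, HasDerivAt p₂' (m s * p₂ s) s := by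
    intro s hs
    have := (hFpos s t₀).ne'
    refine HasDerivAt.congr_deriv (((((hFs s hs t₀ ht₀).mul (hasDerivAt_slice_fst (D hlu hs ht₀))).mul
      (hvs s hs t₀ ht₀)).add (((hFs s hs t₀ ht₀).inv this).const_mul c)).const_mul (a / c)) ?_
    simp only [hmdef, hp₂, Pi.mul_apply]; field_simp; ring
  have hW : ∀ s, p₁ s * p₂' s - p₂ s * p₁' s = a := by
    intro s
    have := (hFpos s t₀).ne'
    simp only [hp₁, hp₁', hp₂, hp₂']; field_simp; ring
  have hconst : ∀ y y' : ℝ → ℝ, (∀ s ∈ ball s₀ r, HasDerivAt y (y' s) s) →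
      (∀ s ∈ ball s₀ r, HasDerivAt y' (m s * y s) s) → ∀ s ∈ ball s₀ r, ∀ t ∈ ball t₀ r,
      F s t * y' s - F s t * pu l (s, t) * y s =
        F s₀ t * y' s₀ - F s₀ t * pu l (s₀, t) * y s₀ := by
    intro y y' hy hy' s hs t ht
    refine eq_of_hasDerivAt_zero_on_ball
      (f := fun s => F s t * y' s - F s t * pu l (s, t) * y s) (fun s hs => ?_) hs hs₀
    refine HasDerivAt.congr_deriv (((hFs s hs t ht).mul (hy' s hs)).sub
      (((hFs s hs t ht).mul (hasDerivAt_slice_fst (D hlu hs ht))).mul (hy s hs))) ?_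
    have := hm s hs t ht
    simp only [hmdef, Pi.mul_apply]
    rw [← this]
    ring
  set q₁ : ℝ → ℝ := fun t => (F s₀ t * p₁' s₀ - F s₀ t * pu l (s₀, t) * p₁ s₀) / a with hq₁
  set q₂ : ℝ → ℝ := fun t => (F s₀ t * p₂' s₀ - F s₀ t * pu l (s₀, t) * p₂ s₀) / a with hq₂
  have dq : ∀ y y' : ℝ, ∀ t ∈ ball t₀ r,
      HasDerivAt (fun t => (F s₀ t * y' - F s₀ t * pu l (s₀, t) * y) / a)
        ((F s₀ t * pv l (s₀, t) * y' - (F s₀ t * pv l (s₀, t) * pu l (s₀, t) +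
          c * (F s₀ t)⁻¹) * y) / a) t := by
    intro y y' t ht
    refine HasDerivAt.congr_deriv ((((hFt s₀ hs₀ t ht).mul_const y').sub
      (((hFt s₀ hs₀ t ht).mul (hut s₀ hs₀ t ht)).mul_const y)).div_const a) ?_
    have := (hFpos s₀ t).ne'
    field_simp
  have sl1 : ContDiffOn ℝ (⊤ : ℕ∞) (fun s : ℝ => (s, t₀)) (ball s₀ r) :=
    (contDiff_id.prodMk contDiff_const).contDiffOn
  have sl2 : ContDiffOn ℝ (⊤ : ℕ∞) (fun t : ℝ => (s₀, t)) (ball t₀ r) :=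
    (contDiff_const.prodMk contDiff_id).contDiffOn
  have m1 : MapsTo (fun s : ℝ => (s, t₀)) (ball s₀ r) (ball s₀ r ×ˢ ball t₀ r) :=
    fun s hs => ⟨hs, ht₀⟩
  have m2 : MapsTo (fun t : ℝ => (s₀, t)) (ball t₀ r) (ball s₀ r ×ˢ ball t₀ r) :=
    fun t ht => ⟨hs₀, ht⟩
  have cF1 : ContDiffOn ℝ (⊤ : ℕ∞) (fun s => F s t₀) (ball s₀ r) := (hl.comp sl1 m1).exp
  have cF2 : ContDiffOn ℝ (⊤ : ℕ∞) (fun t => F s₀ t) (ball t₀ r) := (hl.comp sl2 m2).exp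
  have cq : ∀ y y' : ℝ, ContDiffOn ℝ (⊤ : ℕ∞)
      (fun t => (F s₀ t * y' - F s₀ t * pu l (s₀, t) * y) / a) (ball t₀ r) := fun y y' =>
    ((cF2.mul contDiffOn_const).sub
      ((cF2.mul (hlu.comp sl2 m2)).mul contDiffOn_const)).div_const a
  refine ⟨p₁, p₂, q₁, q₂, cF1, contDiffOn_const.mul (cF1.mul (hlv.comp sl1 m1)),
    cq _ _, cq _ _, ?_, ?_, ?_⟩
  · intro s hs
    rw [(dp₁ s hs).deriv, (dp₂ s hs).deriv, hW]
  · intro t ht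
    rw [(dq (p₁ s₀) (p₁' s₀) t ht).deriv, (dq (p₂ s₀) (p₂' s₀) t ht).deriv]
    have h1 := hW s₀
    have h2 := (hFpos s₀ t).ne'
    simp only [hq₁, hq₂]
    generalize p₁ s₀ = x₁ at *
    generalize p₂ s₀ = x₂ at *
    generalize p₁' s₀ = y₁ at *
    generalize p₂' s₀ = y₂ at *
    rw [← mul_right_inj' (pow_ne_zero 2 ha)]
    field_simp
    linear_combination c * h1 - a * hab
  · intro s hs t ht
    have e1 : q₁ t = (F s t * p₁' s - F s t * pu l (s, t) * p₁ s) / a := by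
      simp only [hq₁]; rw [hconst p₁ p₁' dp₁ dp₁' s hs t ht]
    have e2 : q₂ t = (F s t * p₂' s - F s t * pu l (s, t) * p₂ s) / a := by
      simp only [hq₂]; rw [hconst p₂ p₂' dp₂ dp₂' s hs t ht]
    have h1 := hW s
    rw [e1, e2]
    change F s t = _
    rw [← mul_right_inj' ha]
    field_simp
    linear_combination (-F s t) * h1

section ScalarProduct

theorem ip_comm (a b : V4) : ip a b = ip b a := by simp only [ip]; ring

theorem ip_add_left (a b c : V4) : ip (a + b) c = ip a c + ip b c := by
  simp only [ip, Pi.add_apply]; ring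

theorem ip_sub_left (a b c : V4) : ip (a - b) c = ip a c - ip b c := by
  simp only [ip, Pi.sub_apply]; ring

theorem ip_smul_left (k : ℝ) (a c : V4) : ip (k • a) c = k * ip a c := by
  simp only [ip, Pi.smul_apply, smul_eq_mul]; ring

theorem ip_add_right (a b c : V4) : ip c (a + b) = ip c a + ip c b := by
  simp only [ip_comm c, ip_add_left]

theorem ip_sub_right (a b c : V4) : ip c (a - b) = ip c a - ip c b := by
  simp only [ip_comm c, ip_sub_left]

theorem ip_smul_right (k : ℝ) (a c : V4) : ip c (k • a) = k * ip c a := by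
  simp only [ip_comm c, ip_smul_left]

theorem det4_sum_difference (P Q N M : V4) :
    det4 (P + Q) (P - Q) (N + M) (N - M) = 4 * det4 P Q N M := by
  simp [det4, Matrix.det_succ_row_zero, Fin.sum_univ_succ, Fin.succAbove]
  ring

theorem det4_sub_smul (P Q N M : V4) (y z : ℝ) :
    det4 P Q (N - y • P) (M - z • Q) = det4 P Q N M := by
  simp [det4, Matrix.det_succ_row_zero, Fin.sum_univ_succ, Fin.succAbove]
  ring

end ScalarProduct

/-- Curvatures at a point of a minimal surface `α(u + v) + β(u - v)`, with null vectors
`P = α'`, `Q = β'` and `P' = α''`, `Q' = β''`. -/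
theorem curvatures_of_null_curves {x : ℝ × ℝ → V4} {p : ℝ × ℝ} {P Q P' Q' : V4}
    (hu : pu x p = P + Q) (hv : pv x p = P - Q) (huu : pu (pu x) p = P' + Q')
    (huv : pv (pu x) p = P' - Q') (hPP : ip P P = 0) (hQQ : ip Q Q = 0) (hPP' : ip P P' = 0)
    (hQQ' : ip Q Q' = 0) (hP' : ip P' P' = 1 / 4) (hQ' : ip Q' Q' = -1 / 4) (he : ip P Q ≠ 0) :
    Ef x p = 2 * ip P Q ∧ ip (pv x p) (pv x p) = -(Ef x p) ∧ ip (pu x p) (pv x p) = 0 ∧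
    ip (sffA x p) (sffA x p) + ip (sffB x p) (sffB x p) = 0 ∧
    2 * ip (sffA x p) (sffB x p) = 1 ∧
    GaussK x p = -(ip P' Q' * ip P Q - ip P' Q * ip P Q') / (ip P Q) ^ 3 ∧
    NormK x p = - det4 P Q P' Q' / (ip P Q) ^ 3 := by
  have hQP : ip Q P = ip P Q := ip_comm _ _
  have hP'P : ip P' P = 0 := by rw [ip_comm, hPP']
  have hQ'Q : ip Q' Q = 0 := by rw [ip_comm, hQQ']
  have hQ'P : ip Q' P = ip P Q' := ip_comm _ _
  have hQP' : ip Q P' = ip P' Q := ip_comm _ _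
  have hQ'P' : ip Q' P' = ip P' Q' := ip_comm _ _
  have hE : Ef x p = 2 * ip P Q := by
    rw [Ef, hu]
    simp only [ip_add_left, ip_add_right, hPP, hQQ, hQP]; ring
  have hA : sffA x p = (P' - (ip P' Q / ip P Q) • P) + (Q' - (ip P Q' / ip P Q) • Q) := by
    rw [sffA, nproj, hE, huu, hu, hv]
    simp only [ip_add_left, ip_add_right, ip_sub_right, hP'P, hQ'Q, hQ'P]
    ext i
    simp only [Pi.add_apply, Pi.sub_apply, Pi.smul_apply, smul_eq_mul]
    field_simp; ring
  have hB : sffB x p = (P' - (ip P' Q / ip P Q) • P) - (Q' - (ip P Q' / ip P Q) • Q) := by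
    rw [sffB, nproj, hE, huv, hu, hv]
    simp only [ip_sub_left, ip_add_right, ip_sub_right, hP'P, hQ'Q, hQ'P]
    ext i
    simp only [Pi.add_apply, Pi.sub_apply, Pi.smul_apply, smul_eq_mul]
    field_simp; ring
  have hNN : ip (P' - (ip P' Q / ip P Q) • P) (P' - (ip P' Q / ip P Q) • P) = 1 / 4 := by
    simp only [ip_sub_left, ip_sub_right, ip_smul_left, ip_smul_right, hPP, hPP', hP'P, hP']
    ring
  have hMM : ip (Q' - (ip P Q' / ip P Q) • Q) (Q' - (ip P Q' / ip P Q) • Q) = -1 / 4 := by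
    simp only [ip_sub_left, ip_sub_right, ip_smul_left, ip_smul_right, hQQ, hQQ', hQ'Q, hQ']
    ring
  have hNM : ip (P' - (ip P' Q / ip P Q) • P) (Q' - (ip P Q' / ip P Q) • Q) =
      (ip P' Q' * ip P Q - ip P' Q * ip P Q') / ip P Q := by
    simp only [ip_sub_left, ip_sub_right, ip_smul_left, ip_smul_right]
    field_simp; ring
  have hMN := ip_comm (Q' - (ip P Q' / ip P Q) • Q) (P' - (ip P' Q / ip P Q) • P)
  have hdet : det4 (pu x p) (pv x p) (sffA x p) (sffB x p) = 4 * det4 P Q P' Q' := by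
    rw [hu, hv, hA, hB, det4_sum_difference, det4_sub_smul]
  refine ⟨hE, ?_, ?_, ?_, ?_, ?_, ?_⟩
  · rw [hE, hv]
    simp only [ip_sub_left, ip_sub_right, hPP, hQQ, hQP]; ring
  · rw [hu, hv]
    simp only [ip_add_left, ip_sub_right, hPP, hQQ, hQP]; ring
  · rw [hA, hB]
    generalize P' - (ip P' Q / ip P Q) • P = N at *
    generalize Q' - (ip P Q' / ip P Q) • Q = M at *
    simp only [ip_add_left, ip_sub_left, ip_add_right, ip_sub_right, hNN, hMM, hMN]; ring
  · rw [hA, hB]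
    generalize P' - (ip P' Q / ip P Q) • P = N at *
    generalize Q' - (ip P Q' / ip P Q) • Q = M at *
    simp only [ip_add_left, ip_sub_right, hNN, hMM, hMN]; ring
  · rw [GaussK, hE, hA, hB]
    generalize P' - (ip P' Q / ip P Q) • P = N at *
    generalize Q' - (ip P Q' / ip P Q) • Q = M at *
    simp only [ip_add_left, ip_sub_left, ip_add_right, ip_sub_right, hNN, hMM, hMN, hNM]
    field_simp; ring
  · rw [NormK, hE, hdet]
    field_simp; ring

section NullCurves

variable {E : Type*} [NormedAddCommGroup E] [NormedSpace ℝ E] {f g f' g' : ℝ → E} {p : ℝ × ℝ}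

theorem fderiv_null_sum (hf : HasDerivAt f (f' (p.1 + p.2)) (p.1 + p.2))
    (hg : HasDerivAt g (g' (p.1 - p.2)) (p.1 - p.2)) (w : ℝ × ℝ) :
    fderiv ℝ (fun q : ℝ × ℝ => f (q.1 + q.2) + g (q.1 - q.2)) p w =
      (w.1 + w.2) • f' (p.1 + p.2) + (w.1 - w.2) • g' (p.1 - p.2) := by
  have h₁ : HasFDerivAt (fun q : ℝ × ℝ => f (q.1 + q.2)) _ p :=
    HasFDerivAt.comp (f := fun q : ℝ × ℝ => q.1 + q.2) p hf.hasFDerivAt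
      (hasFDerivAt_fst.add hasFDerivAt_snd)
  have h₂ : HasFDerivAt (fun q : ℝ × ℝ => g (q.1 - q.2)) _ p :=
    HasFDerivAt.comp (f := fun q : ℝ × ℝ => q.1 - q.2) p hg.hasFDerivAt
      (hasFDerivAt_fst.sub hasFDerivAt_snd)
  rw [(h₁.fun_add h₂).fderiv]
  simp [add_smul, sub_smul]

theorem pu_null_sum (hf : HasDerivAt f (f' (p.1 + p.2)) (p.1 + p.2))
    (hg : HasDerivAt g (g' (p.1 - p.2)) (p.1 - p.2)) :
    pu (fun q : ℝ × ℝ => f (q.1 + q.2) + g (q.1 - q.2)) p = f' (p.1 + p.2) + g' (p.1 - p.2) := by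
  simp [pu, fderiv_null_sum hf hg]

theorem pv_null_sum (hf : HasDerivAt f (f' (p.1 + p.2)) (p.1 + p.2))
    (hg : HasDerivAt g (g' (p.1 - p.2)) (p.1 - p.2)) :
    pv (fun q : ℝ × ℝ => f (q.1 + q.2) + g (q.1 - q.2)) p = f' (p.1 + p.2) - g' (p.1 - p.2) := by
  rw [pv, fderiv_null_sum hf hg]
  simp [sub_eq_add_neg]

end NullCurves

theorem exists_smooth_primitive {E : Type*} [NormedAddCommGroup E] [NormedSpace ℝ E]
    [CompleteSpace E] {f : ℝ → E} {c r : ℝ} (hf : ContDiffOn ℝ (⊤ : ℕ∞) f (ball c r)) :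
    ∃ F : ℝ → E, ContDiffOn ℝ (⊤ : ℕ∞) F (ball c r) ∧ ∀ s ∈ ball c r, HasDerivAt F (f s) s := by
  have h : ∀ s ∈ ball c r, HasDerivAt (fun s => ∫ y in c..s, f y) (f s) s := by
    intro s hs
    have hr : 0 < r := lt_of_le_of_lt dist_nonneg hs
    have hsub : uIcc c s ⊆ ball c r :=
      (convex_ball c r).ordConnected.uIcc_subset (mem_ball_self hr) hs
    exact intervalIntegral.integral_hasDerivAt_right
      ((hf.continuousOn.mono hsub).intervalIntegrable)
      (hf.continuousOn.stronglyMeasurableAtFilter isOpen_ball s hs)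
      (hf.continuousOn.continuousAt (isOpen_ball.mem_nhds hs))
  refine ⟨fun s => ∫ y in c..s, f y, ?_, h⟩
  rw [contDiffOn_infty_iff_deriv_of_isOpen isOpen_ball]
  exact ⟨fun s hs => (h s hs).differentiableAt.differentiableWithinAt,
    hf.congr fun s hs => (h s hs).deriv⟩

/-- The null vector of `ℝ⁴₂` with spinor components `(p₁, p₂)` and `(q₁, q₂)`. -/
def spinor (p₁ p₂ q₁ q₂ : ℝ) : V4 :=
  ![(p₂ * q₂ - p₁ * q₁) / 2, (p₁ * q₁ + p₂ * q₂) / 2, -(p₁ * q₂ + p₂ * q₁) / 2,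
    (p₁ * q₂ - p₂ * q₁) / 2]

theorem ip_spinor (p₁ p₂ q₁ q₂ r₁ r₂ s₁ s₂ : ℝ) :
    ip (spinor p₁ p₂ q₁ q₂) (spinor r₁ r₂ s₁ s₂) =
      (p₁ * r₂ - p₂ * r₁) * (q₁ * s₂ - q₂ * s₁) / 2 := by
  simp [ip, spinor]; ring

theorem det4_spinor (p₁ p₂ q₁ q₂ P₁ P₂ Q₁ Q₂ p₁' p₂' q₁' q₂' P₁' P₂' Q₁' Q₂' : ℝ) :
    det4 (spinor p₁ p₂ q₁ q₂) (spinor P₁ P₂ Q₁ Q₂)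
      (spinor p₁' p₂' q₁ q₂ + spinor p₁ p₂ q₁' q₂') (spinor P₁' P₂' Q₁ Q₂ + spinor P₁ P₂ Q₁' Q₂') =
      -((q₁ * Q₂ - q₂ * Q₁) ^ 2 * (p₁ * p₂' - p₂ * p₁') * (P₁ * P₂' - P₂ * P₁') -
        (p₁ * P₂ - p₂ * P₁) ^ 2 * (q₁ * q₂' - q₂ * q₁') * (Q₁ * Q₂' - Q₂ * Q₁')) / 4 := by
  simp [det4, spinor, Matrix.det_succ_row_zero, Fin.sum_univ_succ, Fin.succAbove]
  ring

theorem contDiffOn_spinor {p₁ p₂ q₁ q₂ : ℝ → ℝ} {I : Set ℝ}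
    (h₁ : ContDiffOn ℝ (⊤ : ℕ∞) p₁ I) (h₂ : ContDiffOn ℝ (⊤ : ℕ∞) p₂ I)
    (h₃ : ContDiffOn ℝ (⊤ : ℕ∞) q₁ I) (h₄ : ContDiffOn ℝ (⊤ : ℕ∞) q₂ I) :
    ContDiffOn ℝ (⊤ : ℕ∞) (fun s => spinor (p₁ s) (p₂ s) (q₁ s) (q₂ s)) I := by
  rw [contDiffOn_pi]
  intro i
  fin_cases i <;> simp [spinor] <;> fun_prop

theorem hasDerivAt_spinor {p₁ p₂ q₁ q₂ : ℝ → ℝ} {p₁' p₂' q₁' q₂' s : ℝ}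
    (h₁ : HasDerivAt p₁ p₁' s) (h₂ : HasDerivAt p₂ p₂' s)
    (h₃ : HasDerivAt q₁ q₁' s) (h₄ : HasDerivAt q₂ q₂' s) :
    HasDerivAt (fun s => spinor (p₁ s) (p₂ s) (q₁ s) (q₂ s))
      (spinor p₁' p₂' (q₁ s) (q₂ s) + spinor (p₁ s) (p₂ s) q₁' q₂') s := by
  rw [hasDerivAt_pi]
  intro i
  fin_cases i
  · exact (((h₂.mul h₄).sub (h₁.mul h₃)).div_const 2).congr_deriv (by simp [spinor]; ring)
  · exact (((h₁.mul h₃).add (h₂.mul h₄)).div_const 2).congr_deriv (by simp [spinor]; ring)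
  · exact (((h₁.mul h₄).add (h₂.mul h₃)).neg.div_const 2).congr_deriv (by simp [spinor]; ring)
  · exact (((h₁.mul h₄).sub (h₂.mul h₃)).div_const 2).congr_deriv (by simp [spinor]; ring)

/-- The surface generated by four plane curves with constant Wronskians. -/
theorem exists_goodSurf_of_curves {s₀ t₀ r a b c d : ℝ}
    {p₁ p₂ q₁ q₂ P₁ P₂ Q₁ Q₂ : ℝ → ℝ}
    (hp₁ : ContDiffOn ℝ (⊤ : ℕ∞) p₁ (ball s₀ r)) (hp₂ : ContDiffOn ℝ (⊤ : ℕ∞) p₂ (ball s₀ r))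
    (hq₁ : ContDiffOn ℝ (⊤ : ℕ∞) q₁ (ball s₀ r)) (hq₂ : ContDiffOn ℝ (⊤ : ℕ∞) q₂ (ball s₀ r))
    (hP₁ : ContDiffOn ℝ (⊤ : ℕ∞) P₁ (ball t₀ r)) (hP₂ : ContDiffOn ℝ (⊤ : ℕ∞) P₂ (ball t₀ r))
    (hQ₁ : ContDiffOn ℝ (⊤ : ℕ∞) Q₁ (ball t₀ r)) (hQ₂ : ContDiffOn ℝ (⊤ : ℕ∞) Q₂ (ball t₀ r))
    (hp : ∀ s ∈ ball s₀ r, p₁ s * deriv p₂ s - p₂ s * deriv p₁ s = a)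
    (hP : ∀ t ∈ ball t₀ r, P₁ t * deriv P₂ t - P₂ t * deriv P₁ t = b)
    (hq : ∀ s ∈ ball s₀ r, q₁ s * deriv q₂ s - q₂ s * deriv q₁ s = c)
    (hQ : ∀ t ∈ ball t₀ r, Q₁ t * deriv Q₂ t - Q₂ t * deriv Q₁ t = d)
    (hac : a * c = -1 / 4) (hbd : b * d = 1 / 4) {f g : ℝ → ℝ → ℝ}
    (hf : ∀ s ∈ ball s₀ r, ∀ t ∈ ball t₀ r, f s t = p₁ s * P₂ t - p₂ s * P₁ t)
    (hg : ∀ s ∈ ball s₀ r, ∀ t ∈ ball t₀ r, g s t = q₁ s * Q₂ t - q₂ s * Q₁ t)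
    (hfg : ∀ s ∈ ball s₀ r, ∀ t ∈ ball t₀ r, f s t * g s t < 0) :
    ∃ x : ℝ × ℝ → V4,
      GoodSurf {p | p.1 + p.2 ∈ ball s₀ r ∧ p.1 - p.2 ∈ ball t₀ r} x ∧
      ∀ s ∈ ball s₀ r, ∀ t ∈ ball t₀ r, ∀ p : ℝ × ℝ, p.1 + p.2 = s → p.1 - p.2 = t →
        GaussK x p = -2 * (g s t ^ 2 * a * b + f s t ^ 2 * c * d) / (f s t * g s t) ^ 3 ∧
        NormK x p = 2 * (g s t ^ 2 * a * b - f s t ^ 2 * c * d) / (f s t * g s t) ^ 3 := by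
  set U : Set (ℝ × ℝ) := {p | p.1 + p.2 ∈ ball s₀ r ∧ p.1 - p.2 ∈ ball t₀ r} with hUdef
  have hU : IsOpen U :=
    (isOpen_ball.preimage (continuous_fst.add continuous_snd)).inter
      (isOpen_ball.preimage (continuous_fst.sub continuous_snd))
  obtain ⟨α, cα, dα⟩ := exists_smooth_primitive (contDiffOn_spinor hp₁ hp₂ hq₁ hq₂)
  obtain ⟨β, cβ, dβ⟩ := exists_smooth_primitive (contDiffOn_spinor hP₁ hP₂ hQ₁ hQ₂)
  set X : ℝ → V4 := fun s => spinor (p₁ s) (p₂ s) (q₁ s) (q₂ s) with hX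
  set Y : ℝ → V4 := fun t => spinor (P₁ t) (P₂ t) (Q₁ t) (Q₂ t) with hY
  set X' : ℝ → V4 := fun s => spinor (deriv p₁ s) (deriv p₂ s) (q₁ s) (q₂ s) +
    spinor (p₁ s) (p₂ s) (deriv q₁ s) (deriv q₂ s) with hX'
  set Y' : ℝ → V4 := fun t => spinor (deriv P₁ t) (deriv P₂ t) (Q₁ t) (Q₂ t) +
    spinor (P₁ t) (P₂ t) (deriv Q₁ t) (deriv Q₂ t) with hY'
  have D {h : ℝ → ℝ} {e s : ℝ} (hh : ContDiffOn ℝ (⊤ : ℕ∞) h (ball e r)) (hs : s ∈ ball e r) :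
      HasDerivAt h (deriv h s) s :=
    (hh.differentiableAt_of_isOpen isOpen_ball hs).hasDerivAt
  have dX : ∀ s ∈ ball s₀ r, HasDerivAt X (X' s) s := fun s hs =>
    hasDerivAt_spinor (D hp₁ hs) (D hp₂ hs) (D hq₁ hs) (D hq₂ hs)
  have dY : ∀ t ∈ ball t₀ r, HasDerivAt Y (Y' t) t := fun t ht =>
    hasDerivAt_spinor (D hP₁ ht) (D hP₂ ht) (D hQ₁ ht) (D hQ₂ ht)
  set x : ℝ × ℝ → V4 := fun q => α (q.1 + q.2) + β (q.1 - q.2) with hx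
  have xu : ∀ p ∈ U, pu x p = X (p.1 + p.2) + Y (p.1 - p.2) := fun p hp =>
    pu_null_sum (dα _ hp.1) (dβ _ hp.2)
  have xv : ∀ p ∈ U, pv x p = X (p.1 + p.2) - Y (p.1 - p.2) := fun p hp =>
    pv_null_sum (dα _ hp.1) (dβ _ hp.2)
  have xuu : ∀ p ∈ U, pu (pu x) p = X' (p.1 + p.2) + Y' (p.1 - p.2) := fun p hp => by
    rw [pu_congr hU xu hp]
    exact pu_null_sum (dX _ hp.1) (dY _ hp.2)
  have xuv : ∀ p ∈ U, pv (pu x) p = X' (p.1 + p.2) - Y' (p.1 - p.2) := fun p hp => by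
    rw [pv_congr hU xu hp]
    exact pv_null_sum (dX _ hp.1) (dY _ hp.2)
  have xvv : ∀ p ∈ U, pv (pv x) p = X' (p.1 + p.2) + Y' (p.1 - p.2) := fun p hp => by
    have h : ∀ q ∈ U, pv x q = X (q.1 + q.2) + (-Y) (q.1 - q.2) := fun q hq => by
      rw [xv q hq, sub_eq_add_neg, Pi.neg_apply]
    rw [pv_congr hU h hp]
    refine (pv_null_sum (g' := -Y') (dX _ hp.1) (dY _ hp.2).neg).trans ?_
    simp
  have hPQ : ∀ s ∈ ball s₀ r, ∀ t ∈ ball t₀ r, ip (X s) (Y t) = f s t * g s t / 2 := by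
    intro s hs t ht
    rw [hf s hs t ht, hg s hs t ht]
    exact ip_spinor _ _ _ _ _ _ _ _
  have main : ∀ p ∈ U, _ := fun p hp' =>
    curvatures_of_null_curves (xu p hp') (xv p hp') (xuu p hp') (xuv p hp')
    (by simp only [hX, ip_spinor]; ring) (by simp only [hY, ip_spinor]; ring)
    (by simp only [hX, hX', ip_add_right, ip_spinor]; ring)
    (by simp only [hY, hY', ip_add_right, ip_spinor]; ring)
    (by
      simp only [hX', ip_add_right, ip_add_left, ip_spinor]
      linear_combination (-hac) + (q₁ (p.1 + p.2) * deriv q₂ (p.1 + p.2) -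
        q₂ (p.1 + p.2) * deriv q₁ (p.1 + p.2)) * (-hp _ hp'.1) - a * hq _ hp'.1)
    (by
      simp only [hY', ip_add_right, ip_add_left, ip_spinor]
      linear_combination (-hbd) + (Q₁ (p.1 - p.2) * deriv Q₂ (p.1 - p.2) -
        Q₂ (p.1 - p.2) * deriv Q₁ (p.1 - p.2)) * (-hP _ hp'.2) - b * hQ _ hp'.2)
    (by rw [hPQ _ hp'.1 _ hp'.2]; linarith [hfg _ hp'.1 _ hp'.2])
  refine ⟨x, ⟨?_, ?_, ?_, ?_⟩, ?_⟩
  · refine (cα.comp (contDiff_fst.add contDiff_snd).contDiffOn fun p hp => hp.1).add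
      (cβ.comp (contDiff_fst.sub contDiff_snd).contDiffOn fun p hp => hp.2)
  · intro p hp
    obtain ⟨h1, h2, h3, -⟩ := main p hp
    refine ⟨?_, h2, h3⟩
    rw [h1, hPQ _ hp.1 _ hp.2]
    linarith [hfg _ hp.1 _ hp.2]
  · intro p hp
    rw [xuu p hp, xvv p hp, sub_self]
  · intro p hp
    obtain ⟨-, -, -, h4, h5, -⟩ := main p hp
    exact ⟨h4, h5⟩
  · rintro _ hs _ ht p rfl rfl
    obtain ⟨-, -, -, -, -, h6, h7⟩ := main p ⟨hs, ht⟩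
    have hne := (hfg _ hs _ ht).ne
    rw [h6, h7, hPQ _ hs _ ht, ← hp _ hs, ← hP _ ht, ← hq _ hs, ← hQ _ ht, hX, hX', hY, hY',
      det4_spinor]
    simp only [ip_add_right, ip_add_left, ip_spinor]
    rw [hf _ hs _ ht, hg _ hs _ ht] at hne ⊢
    constructor
    · field_simp
      ring
    · field_simp
      ring

/-- The linear change from null coordinates `(u + v, u - v)` back to `(u, v)`. -/
def ofNull : ℝ × ℝ →L[ℝ] ℝ × ℝ :=
  ((1 / 2 : ℝ) • (ContinuousLinearMap.fst ℝ ℝ ℝ + ContinuousLinearMap.snd ℝ ℝ ℝ)).prod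
    ((1 / 2 : ℝ) • (ContinuousLinearMap.fst ℝ ℝ ℝ - ContinuousLinearMap.snd ℝ ℝ ℝ))

theorem ofNull_add_sub (p : ℝ × ℝ) : ofNull (p.1 + p.2, p.1 - p.2) = p := by
  ext <;> simp [ofNull] <;> ring

theorem pu_comp_ofNull {f : ℝ × ℝ → ℝ} {q : ℝ × ℝ} (hf : DifferentiableAt ℝ f (ofNull q)) :
    pu (fun q => f (ofNull q)) q = (1 / 2) * pu f (ofNull q) + (1 / 2) * pv f (ofNull q) := by
  have h : HasFDerivAt (fun q => f (ofNull q)) _ q := hf.hasFDerivAt.comp q ofNull.hasFDerivAt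
  have e : ofNull (1, 0) = (1 / 2 : ℝ) • ((1, 0) : ℝ × ℝ) + (1 / 2 : ℝ) • ((0, 1) : ℝ × ℝ) := by
    ext <;> simp [ofNull]
  rw [pu, h.fderiv, ContinuousLinearMap.comp_apply, e, map_add, map_smul, map_smul]
  rfl

theorem pv_comp_ofNull {f : ℝ × ℝ → ℝ} {q : ℝ × ℝ} (hf : DifferentiableAt ℝ f (ofNull q)) :
    pv (fun q => f (ofNull q)) q = (1 / 2) * pu f (ofNull q) - (1 / 2) * pv f (ofNull q) := by
  have h : HasFDerivAt (fun q => f (ofNull q)) _ q := hf.hasFDerivAt.comp q ofNull.hasFDerivAt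
  have e : ofNull (0, 1) = (1 / 2 : ℝ) • ((1, 0) : ℝ × ℝ) - (1 / 2 : ℝ) • ((0, 1) : ℝ × ℝ) := by
    ext <;> simp [ofNull]
  rw [pv, h.fderiv, ContinuousLinearMap.comp_apply, e, map_sub, map_smul, map_smul]
  rfl

theorem pu_linear_comb {f g : ℝ × ℝ → ℝ} {p : ℝ × ℝ} (k m : ℝ) (hf : DifferentiableAt ℝ f p)
    (hg : DifferentiableAt ℝ g p) :
    pu (fun q => k * f q + m * g q) p = k * pu f p + m * pu g p := by
  rw [pu, ((hf.hasFDerivAt.const_mul k).fun_add (hg.hasFDerivAt.const_mul m)).fderiv]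
  rfl

theorem pv_linear_comb {f g : ℝ × ℝ → ℝ} {p : ℝ × ℝ} (k m : ℝ) (hf : DifferentiableAt ℝ f p)
    (hg : DifferentiableAt ℝ g p) :
    pv (fun q => k * f q + m * g q) p = k * pv f p + m * pv g p := by
  rw [pv, ((hf.hasFDerivAt.const_mul k).fun_add (hg.hasFDerivAt.const_mul m)).fderiv]
  rfl

theorem hlap_linear_comb {f g : ℝ × ℝ → ℝ} {U : Set (ℝ × ℝ)} (hU : IsOpen U)
    (hf : ContDiffOn ℝ (⊤ : ℕ∞) f U) (hg : ContDiffOn ℝ (⊤ : ℕ∞) g U) (k m : ℝ) {p : ℝ × ℝ}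
    (hp : p ∈ U) : hlap (fun q => k * f q + m * g q) p = k * hlap f p + m * hlap g p := by
  have D {f : ℝ × ℝ → ℝ} (hf : ContDiffOn ℝ (⊤ : ℕ∞) f U) {q : ℝ × ℝ} (hq : q ∈ U) :
      DifferentiableAt ℝ f q := hf.differentiableAt_of_isOpen hU hq
  rw [hlap, pu_congr hU (fun q hq => pu_linear_comb k m (D hf hq) (D hg hq)) hp,
    pv_congr hU (fun q hq => pv_linear_comb k m (D hf hq) (D hg hq)) hp,
    pu_linear_comb k m (D (hf.pu hU) hp) (D (hg.pu hU) hp),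
    pv_linear_comb k m (D (hf.pv hU) hp) (D (hg.pv hU) hp), hlap, hlap]
  ring

/-- In null coordinates the hyperbolic Laplacian is a multiple of the mixed derivative. -/
theorem pv_pu_comp_ofNull {f : ℝ × ℝ → ℝ} {U : Set (ℝ × ℝ)} (hU : IsOpen U)
    (hf : ContDiffOn ℝ (⊤ : ℕ∞) f U) {q : ℝ × ℝ} (hq : ofNull q ∈ U) :
    pv (pu fun q => f (ofNull q)) q = hlap f (ofNull q) / 4 := by
  have D {f : ℝ × ℝ → ℝ} (hf : ContDiffOn ℝ (⊤ : ℕ∞) f U) {q : ℝ × ℝ} (hq : q ∈ U) :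
      DifferentiableAt ℝ f q := hf.differentiableAt_of_isOpen hU hq
  have hu := D (hf.pu hU) hq
  have hv := D (hf.pv hU) hq
  rw [pv_congr (hU.preimage ofNull.continuous) (fun q hq => pu_comp_ofNull (D hf hq)) hq,
    pv_comp_ofNull (f := fun p => 1 / 2 * pu f p + 1 / 2 * pv f p)
      ((hu.const_mul (1 / 2)).add (hv.const_mul (1 / 2))),
    pu_linear_comb _ _ hu hv, pv_linear_comb _ _ hu hv, pu_pv_eq_pv_pu hf hU hq, hlap]
  ring

/-- Pointwise form of the natural equations in terms of `C = |K + ϰ|^{1/8}` and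
`S = |K - ϰ|^{1/8}`. -/
theorem natural_equations_pointwise {K κ σ : ℝ} (hσ : σ ^ 2 = 1) (h : K ^ 2 - κ ^ 2 < 0)
    (hκ : σ * κ < 0) :
    ∃ C S : ℝ, 0 < C ∧ 0 < S ∧ K + κ = -σ * C ^ 8 ∧ K - κ = σ * S ^ 8 ∧
      |K ^ 2 - κ ^ 2| ^ ((1 : ℝ) / 4) = C ^ 2 * S ^ 2 ∧
      Real.exp (-1 / 8 * Real.log |K ^ 2 - κ ^ 2| + 1 / 4 * Real.log |(K + κ) / (K - κ)|) =
        C / S ^ 3 ∧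
      Real.exp (-1 / 8 * Real.log |K ^ 2 - κ ^ 2| + -1 / 4 * Real.log |(K + κ) / (K - κ)|) =
        S / C ^ 3 := by
  obtain ⟨ha, hb⟩ : 0 < -σ * (K + κ) ∧ 0 < σ * (K - κ) := by
    have h1 : (σ - 1) * (σ + 1) = 0 := by linear_combination hσ
    rcases mul_eq_zero.1 h1 with h1 | h1
    · obtain rfl := sub_eq_zero.1 h1
      constructor <;> nlinarith
    · obtain rfl := eq_neg_of_add_eq_zero_left h1
      constructor <;> nlinarith
  set a := -σ * (K + κ) with ha'
  set b := σ * (K - κ) with hb'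
  have hKa : K + κ = -σ * a := by rw [ha']; linear_combination (-(K + κ)) * hσ
  have hKb : K - κ = σ * b := by rw [hb']; linear_combination (-(K - κ)) * hσ
  clear_value a b
  have hσ' : |σ| = 1 := by rwa [← sq_eq_sq₀ (abs_nonneg _) zero_le_one, sq_abs, one_pow]
  have h1 : |K ^ 2 - κ ^ 2| = a * b := by
    rw [show K ^ 2 - κ ^ 2 = -(σ ^ 2 * (a * b)) by linear_combination (K - κ) * hKa - σ * a * hKb,
      hσ, abs_neg, one_mul, abs_of_pos (mul_pos ha hb)]
  have h2 : |(K + κ) / (K - κ)| = a / b := by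
    rw [hKa, hKb, abs_div, abs_mul, abs_mul, abs_neg, hσ', abs_of_pos ha, abs_of_pos hb]
    simp
  have e : ∀ x y : ℝ, Real.exp (x - 3 * y) = Real.exp x / Real.exp y ^ 3 := by
    intro x y
    rw [Real.exp_sub, ← Real.exp_nat_mul]; norm_num
  have e8 : ∀ x : ℝ, 0 < x → Real.exp (Real.log x / 8) ^ 8 = x := by
    intro x hx
    rw [← Real.exp_nat_mul]
    push_cast
    rw [mul_div_cancel₀ _ (by norm_num), Real.exp_log hx]
  refine ⟨Real.exp (Real.log a / 8), Real.exp (Real.log b / 8), Real.exp_pos _, Real.exp_pos _,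
    ?_, ?_, ?_, ?_, ?_⟩
  · rw [e8 a ha, hKa]
  · rw [e8 b hb, hKb]
  · rw [h1, Real.rpow_def_of_pos (mul_pos ha hb), Real.log_mul ha.ne' hb.ne',
      ← Real.exp_nat_mul, ← Real.exp_nat_mul, ← Real.exp_add]
    congr 1; push_cast; ring
  · rw [h1, h2, Real.log_mul ha.ne' hb.ne', Real.log_div ha.ne' hb.ne', ← e]
    congr 1; ring
  · rw [h1, h2, Real.log_mul ha.ne' hb.ne', Real.log_div ha.ne' hb.ne', ← e]
    congr 1; ring

theorem exists_surface_of_natural_equations {D : Set (ℝ × ℝ)} (hD : IsOpen D)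
    {K κ : ℝ × ℝ → ℝ} {σ : ℝ} (hσ : σ ^ 2 = 1)
    (hK : ContDiffOn ℝ (⊤ : ℕ∞) K D) (hκ : ContDiffOn ℝ (⊤ : ℕ∞) κ D)
    (hsign : ∀ p ∈ D, K p ^ 2 - κ p ^ 2 < 0) (hκσ : ∀ p ∈ D, σ * κ p < 0)
    (heq1 : ∀ p ∈ D, |K p ^ 2 - κ p ^ 2| ^ ((1 : ℝ) / 4) *
      hlap (fun s => Real.log |K s ^ 2 - κ s ^ 2|) p = -8 * K p)
    (heq2 : ∀ p ∈ D, |K p ^ 2 - κ p ^ 2| ^ ((1 : ℝ) / 4) *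
      hlap (fun s => Real.log |(K s + κ s) / (K s - κ s)|) p = -4 * κ p)
    {p₀ : ℝ × ℝ} (hp₀ : p₀ ∈ D) :
    ∃ D₀ : Set (ℝ × ℝ), IsOpen D₀ ∧ p₀ ∈ D₀ ∧ D₀ ⊆ D ∧
      ∃ x : ℝ × ℝ → V4, GoodSurf D₀ x ∧ ∀ p ∈ D₀, GaussK x p = K p ∧ NormK x p = κ p := by
  have hσ0 : σ ≠ 0 := by rintro rfl; norm_num at hσ
  have hadd : ∀ p ∈ D, K p + κ p ≠ 0 := fun p hp h0 => by
    have := hsign p hp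
    rw [show K p ^ 2 - κ p ^ 2 = (K p + κ p) * (K p - κ p) by ring, h0, zero_mul] at this
    exact lt_irrefl _ this
  have hsub : ∀ p ∈ D, K p - κ p ≠ 0 := fun p hp h0 => by
    have := hsign p hp
    rw [show K p ^ 2 - κ p ^ 2 = (K p + κ p) * (K p - κ p) by ring, h0, mul_zero] at this
    exact lt_irrefl _ this
  set L : ℝ × ℝ → ℝ := fun s => Real.log |K s ^ 2 - κ s ^ 2| with hL
  set M : ℝ × ℝ → ℝ := fun s => Real.log |(K s + κ s) / (K s - κ s)| with hM
  have cL : ContDiffOn ℝ (⊤ : ℕ∞) L D := by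
    simp only [hL, Real.log_abs]
    exact ((hK.pow 2).sub (hκ.pow 2)).log fun p hp => (hsign p hp).ne
  have cM : ContDiffOn ℝ (⊤ : ℕ∞) M D := by
    simp only [hM, Real.log_abs]
    exact ((hK.add hκ).div (hK.sub hκ) hsub).log fun p hp => div_ne_zero (hadd p hp) (hsub p hp)
  set lf : ℝ × ℝ → ℝ := fun s => -1 / 8 * L s + 1 / 4 * M s with hlf
  set lg : ℝ × ℝ → ℝ := fun s => -1 / 8 * L s + -1 / 4 * M s with hlg
  have clf : ContDiffOn ℝ (⊤ : ℕ∞) lf D :=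
    (contDiffOn_const.mul cL).add (contDiffOn_const.mul cM)
  have clg : ContDiffOn ℝ (⊤ : ℕ∞) lg D :=
    (contDiffOn_const.mul cL).add (contDiffOn_const.mul cM)
  have key : ∀ p ∈ D, ∃ C S : ℝ, 0 < C ∧ 0 < S ∧ K p + κ p = -σ * C ^ 8 ∧
      K p - κ p = σ * S ^ 8 ∧ Real.exp (lf p) = C / S ^ 3 ∧ Real.exp (lg p) = S / C ^ 3 ∧
      hlap lf p = σ * Real.exp (-2 * lf p) ∧ hlap lg p = -σ * Real.exp (-2 * lg p) := by
    intro p hp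
    obtain ⟨C, S, hC, hS, h1, h2, h3, h4, h5⟩ :=
      natural_equations_pointwise hσ (hsign p hp) (hκσ p hp)
    have e : ∀ x : ℝ, Real.exp (-2 * x) = (Real.exp x ^ 2)⁻¹ := by
      intro x
      rw [← Real.exp_nat_mul, ← Real.exp_neg]; congr 1; push_cast; ring
    have q1 := heq1 p hp
    have q2 := heq2 p hp
    rw [h3] at q1 q2
    have h4' : Real.exp (lf p) = C / S ^ 3 := h4
    have h5' : Real.exp (lg p) = S / C ^ 3 := h5
    refine ⟨C, S, hC, hS, h1, h2, h4', h5', ?_, ?_⟩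
    · rw [hlap_linear_comb hD cL cM _ _ hp, e, h4']
      have e1 : C ^ 2 * S ^ 2 * (σ * ((C / S ^ 3) ^ 2)⁻¹) = σ * S ^ 8 := by field_simp
      refine mul_left_cancel₀ (by positivity : C ^ 2 * S ^ 2 ≠ 0) ?_
      rw [e1]
      linear_combination (-1 / 8) * q1 + 1 / 4 * q2 + h2
    · rw [hlap_linear_comb hD cL cM _ _ hp, e, h5']
      have e1 : C ^ 2 * S ^ 2 * (-σ * ((S / C ^ 3) ^ 2)⁻¹) = -σ * C ^ 8 := by field_simp
      refine mul_left_cancel₀ (by positivity : C ^ 2 * S ^ 2 ≠ 0) ?_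
      rw [e1]
      linear_combination (-1 / 8) * q1 - 1 / 4 * q2 + h1
  obtain ⟨r, hr, hball⟩ := Metric.isOpen_iff.1 (hD.preimage ofNull.continuous)
    (p₀.1 + p₀.2, p₀.1 - p₀.2) (by simpa only [mem_preimage, ofNull_add_sub] using hp₀)
  rw [← ball_prod_same] at hball
  set s₀ := p₀.1 + p₀.2
  set t₀ := p₀.1 - p₀.2
  have cN : ContDiffOn ℝ (⊤ : ℕ∞) (fun q => ofNull q) (ball s₀ r ×ˢ ball t₀ r) :=
    ofNull.contDiff.contDiffOn
  obtain ⟨p₁, p₂, P₁, P₂, hp₁, hp₂, hP₁, hP₂, hp, hP, hf⟩ :=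
    exists_curves_of_liouville (a := σ / 2) (b := 1 / 2) (c := σ / 4) hr
      (clf.comp cN hball)
      (fun q hq => by
        obtain ⟨C, S, -, -, -, -, -, -, h, -⟩ := key _ (hball hq)
        refine (pv_pu_comp_ofNull hD clf (hball hq)).trans ?_
        rw [h, Function.comp]; ring)
      (by simpa using hσ0) (by ring)
  obtain ⟨q₁, q₂, Q₁, Q₂, hq₁, hq₂, hQ₁, hQ₂, hq, hQ, hg⟩ :=
    exists_curves_of_liouville (a := -σ / 2) (b := 1 / 2) (c := -σ / 4) hr
      (clg.comp cN hball)
      (fun q hq => by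
        obtain ⟨C, S, -, -, -, -, -, -, -, h⟩ := key _ (hball hq)
        refine (pv_pu_comp_ofNull hD clg (hball hq)).trans ?_
        rw [h, Function.comp]; ring)
      (by simpa using hσ0) (by ring)
  obtain ⟨x, hx, hcurv⟩ := exists_goodSurf_of_curves hp₁ hp₂ hq₁ hq₂ hP₁ hP₂ hQ₁.neg hQ₂.neg
    hp hP hq (d := 1 / 2) (fun t ht => by
      rw [deriv.fun_neg, deriv.fun_neg, ← hQ t ht]; ring)
    (by linear_combination (-1 / 4) * hσ) (by norm_num)
    (f := fun s t => Real.exp (lf (ofNull (s, t)))) (g := fun s t => -Real.exp (lg (ofNull (s, t))))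
    hf (fun s hs t ht => by
      have := hg s hs t ht
      simp only [Function.comp] at this
      rw [this]; ring)
    (fun s hs t ht => by
      rw [mul_neg, neg_lt_zero]
      exact mul_pos (Real.exp_pos _) (Real.exp_pos _))
  have hmem : ∀ p : ℝ × ℝ, p.1 + p.2 ∈ ball s₀ r ∧ p.1 - p.2 ∈ ball t₀ r → p ∈ D := by
    intro p hp
    have := hball (mk_mem_prod hp.1 hp.2)
    rwa [mem_preimage, ofNull_add_sub] at this
  refine ⟨{p | p.1 + p.2 ∈ ball s₀ r ∧ p.1 - p.2 ∈ ball t₀ r},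
    (isOpen_ball.preimage (continuous_fst.add continuous_snd)).inter
      (isOpen_ball.preimage (continuous_fst.sub continuous_snd)),
    ⟨mem_ball_self hr, mem_ball_self hr⟩, hmem, x, hx, fun p hp => ?_⟩
  obtain ⟨hGK, hNK⟩ := hcurv _ hp.1 _ hp.2 p rfl rfl
  obtain ⟨C, S, hC, hS, h1, h2, h3, h4, -⟩ := key p (hmem p hp)
  rw [hGK, hNK]
  simp only [ofNull_add_sub, h3, h4]
  constructor
  · trans σ / 2 * (S ^ 8 - C ^ 8)
    · field_simp
      ring
    · linear_combination (-1 / 2) * h1 - 1 / 2 * h2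
  · trans -σ / 2 * (S ^ 8 + C ^ 8)
    · field_simp
      ring
    · linear_combination (-1 / 2) * h1 + 1 / 2 * h2

section Uniqueness

variable {U : Set (ℝ × ℝ)}

/-- The matrix of the scalar product `ip`. -/
def ipMatrix : Matrix (Fin 4) (Fin 4) ℝ := Matrix.diagonal ![-1, 1, -1, 1]

theorem ip_eq_mulVec (v w : V4) : ip v w = v ⬝ᵥ (ipMatrix.mulVec w) := by
  simp [ip, ipMatrix, dotProduct, Fin.sum_univ_four, Matrix.mulVec_diagonal]
  ring

theorem mul_ipMatrix_mul_transpose_apply (F G : Fin 4 → V4) (i j : Fin 4) :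
    (Matrix.of F * ipMatrix * (Matrix.of G).transpose) i j = ip (F i) (G j) := by
  simp [ip, ipMatrix, Matrix.mul_apply, Fin.sum_univ_four]
  ring

theorem det_ipMatrix : ipMatrix.det = 1 := by
  simp [ipMatrix, Fin.prod_univ_four]

/-- The square of the determinant in terms of the Gram matrix, for vectors of which the last two
are orthogonal to the first two, themselves orthogonal. -/
theorem det4_sq_of_orthogonal {P Q N M : V4} {e : ℝ} (hPP : ip P P = e) (hQQ : ip Q Q = -e)
    (hPQ : ip P Q = 0) (hPN : ip P N = 0) (hPM : ip P M = 0) (hQN : ip Q N = 0)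
    (hQM : ip Q M = 0) :
    det4 P Q N M ^ 2 = -e ^ 2 * (ip N N * ip M M - ip N M ^ 2) := by
  have h : Matrix.of ![P, Q, N, M] * ipMatrix * (Matrix.of ![P, Q, N, M]).transpose =
      !![e, 0, 0, 0; 0, -e, 0, 0; 0, 0, ip N N, ip N M; 0, 0, ip N M, ip M M] := by
    ext i j
    rw [mul_ipMatrix_mul_transpose_apply]
    fin_cases i <;> fin_cases j <;>
      simp [hPP, hQQ, hPQ, hPN, hPM, hQN, hQM, ip_comm Q P, ip_comm N P, ip_comm N Q, ip_comm M P,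
        ip_comm M Q, ip_comm M N]
  have h' := congrArg Matrix.det h
  rw [Matrix.det_mul, Matrix.det_mul, det_ipMatrix, Matrix.det_transpose, mul_one] at h'
  rw [det4, Matrix.det_transpose, sq, h']
  simp [Matrix.det_succ_row_zero, Fin.sum_univ_succ, Fin.succAbove]
  ring

theorem det4_normal (P Q N M : V4) (k l m n : ℝ) :
    det4 P Q (N - k • P + l • Q) (M - m • P + n • Q) = det4 P Q N M := by
  simp [det4, Matrix.det_succ_row_zero, Fin.sum_univ_succ, Fin.succAbove]
  ring

theorem contDiffOn_det {n : ℕ} {m : Type*} [Fintype m] [DecidableEq m]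
    {R : ℝ × ℝ → Matrix m m ℝ}
    (hR : ∀ i j, ContDiffOn ℝ n (fun p => R p i j) U) :
    ContDiffOn ℝ n (fun p => (R p).det) U := by
  simp only [Matrix.det_apply]
  exact ContDiffOn.sum fun s _ => (contDiffOn_prod fun i _ => hR _ _).const_smul _

theorem contDiffOn_inv_apply {n : ℕ} {m : Type*} [Fintype m] [DecidableEq m]
    {R : ℝ × ℝ → Matrix m m ℝ}
    (hR : ∀ i j, ContDiffOn ℝ n (fun p => R p i j) U) (hdet : ∀ p ∈ U, (R p).det ≠ 0) (i j : m) :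
    ContDiffOn ℝ n (fun p => (R p)⁻¹ i j) U := by
  simp only [Matrix.inv_def, Ring.inverse_eq_inv', Matrix.smul_apply, smul_eq_mul,
    Matrix.adjugate_apply]
  refine ((contDiffOn_det hR).inv hdet).mul (contDiffOn_det fun k l => ?_)
  by_cases h : k = j
  · subst h
    simpa using contDiffOn_const
  · simpa [Matrix.updateRow_ne h] using hR k l

theorem fderiv_transition_eq_zero {R₁ R₂ B : ℝ × ℝ → Matrix (Fin 4) (Fin 4) ℝ} (hU : IsOpen U)
    (hR₁ : ∀ i j, ∀ p ∈ U, DifferentiableAt ℝ (fun p => R₁ p i j) p)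
    (hB : ∀ i j, ∀ p ∈ U, DifferentiableAt ℝ (fun p => B p i j) p)
    (hRB : ∀ p ∈ U, R₁ p * B p = R₂ p)
    {p : ℝ × ℝ} (hp : p ∈ U) (h₁ : (R₁ p).det ≠ 0) (h₂ : (R₂ p).det ≠ 0)
    (hG : R₁ p * ipMatrix * (R₁ p).transpose = R₂ p * ipMatrix * (R₂ p).transpose)
    {w : ℝ × ℝ} {S₁ S₂ : Matrix (Fin 4) (Fin 4) ℝ}
    (hS₁ : ∀ i j, fderiv ℝ (fun p => R₁ p i j) p w = S₁ i j)
    (hS₂ : ∀ i j, fderiv ℝ (fun p => R₂ p i j) p w = S₂ i j)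
    (hS : S₁ * ipMatrix * (R₁ p).transpose = S₂ * ipMatrix * (R₂ p).transpose) (i j : Fin 4) :
    fderiv ℝ (fun p => B p i j) p w = 0 := by
  set T : Matrix (Fin 4) (Fin 4) ℝ := Matrix.of fun i j => fderiv ℝ (fun p => B p i j) p w with hT
  have hprod : S₁ * B p + R₁ p * T = S₂ := by
    ext i j
    have e : (fun q => R₂ q i j) =ᶠ[nhds p] fun q => ∑ k, R₁ q i k * B q k j :=
      Filter.eventuallyEq_of_mem (hU.mem_nhds hp) fun q hq => by
        simp only [← hRB q hq, Matrix.mul_apply]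
    have d := HasFDerivAt.fun_sum (u := Finset.univ)
      fun k _ => (hR₁ i k p hp).hasFDerivAt.mul (hB k j p hp).hasFDerivAt
    rw [← hS₂, e.fderiv_eq]
    erw [d.fderiv]
    simp [Matrix.mul_apply, hT, ← hS₁, Finset.sum_add_distrib, mul_comm, add_comm]
  have u₁ : IsUnit (R₁ p) := (Matrix.isUnit_iff_isUnit_det _).2 (isUnit_iff_ne_zero.2 h₁)
  have u₂ : IsUnit (ipMatrix * (R₂ p).transpose) := by
    rw [Matrix.isUnit_iff_isUnit_det, Matrix.det_mul, det_ipMatrix, Matrix.det_transpose, one_mul]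
    exact isUnit_iff_ne_zero.2 h₂
  have hB' : B p * (ipMatrix * (R₂ p).transpose) = ipMatrix * (R₁ p).transpose := by
    refine u₁.mul_left_cancel ?_
    rw [← mul_assoc, hRB p hp, ← mul_assoc, ← hG, mul_assoc]
  have hz : R₁ p * T * (ipMatrix * (R₂ p).transpose) = 0 := by
    have : S₁ * (B p * (ipMatrix * (R₂ p).transpose)) +
        R₁ p * T * (ipMatrix * (R₂ p).transpose) = S₂ * (ipMatrix * (R₂ p).transpose) := by
      rw [← hprod, add_mul, mul_assoc S₁]
    rw [hB', ← mul_assoc S₁, ← mul_assoc S₂, hS] at this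
    exact add_eq_left.1 this
  have hT0 : T = 0 := by
    have := u₂.mul_right_cancel (hz.trans (zero_mul _).symm)
    exact u₁.mul_left_cancel (this.trans (mul_zero _).symm)
  exact congrFun (congrFun hT0 i) j

theorem fderiv_ip_apply {f g : ℝ × ℝ → V4} {p : ℝ × ℝ} (hf : DifferentiableAt ℝ f p)
    (hg : DifferentiableAt ℝ g p) (w : ℝ × ℝ) :
    fderiv ℝ (fun q => ip (f q) (g q)) p w =
      ip (fderiv ℝ f p w) (g p) + ip (f p) (fderiv ℝ g p w) := by
  have F := fun i => hasFDerivAt_pi'.1 hf.hasFDerivAt i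
  have G := fun i => hasFDerivAt_pi'.1 hg.hasFDerivAt i
  have d := ((((F 0).mul (G 0)).neg.add ((F 1).mul (G 1))).sub ((F 2).mul (G 2))).add
    ((F 3).mul (G 3))
  refine (congrArg (fun L : ℝ × ℝ →L[ℝ] ℝ => L w) d.fderiv).trans ?_
  simp [ip]
  ring

theorem pu_ip {f g : ℝ × ℝ → V4} (hU : IsOpen U) (hf : ContDiffOn ℝ (⊤ : ℕ∞) f U)
    (hg : ContDiffOn ℝ (⊤ : ℕ∞) g U) {p : ℝ × ℝ} (hp : p ∈ U) :
    pu (fun q => ip (f q) (g q)) p = ip (pu f p) (g p) + ip (f p) (pu g p) :=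
  fderiv_ip_apply (hf.differentiableAt_of_isOpen hU hp) (hg.differentiableAt_of_isOpen hU hp) _

theorem pv_ip {f g : ℝ × ℝ → V4} (hU : IsOpen U) (hf : ContDiffOn ℝ (⊤ : ℕ∞) f U)
    (hg : ContDiffOn ℝ (⊤ : ℕ∞) g U) {p : ℝ × ℝ} (hp : p ∈ U) :
    pv (fun q => ip (f q) (g q)) p = ip (pv f p) (g p) + ip (f p) (pv g p) :=
  fderiv_ip_apply (hf.differentiableAt_of_isOpen hU hp) (hg.differentiableAt_of_isOpen hU hp) _

/-- Scalar products of normal projections. -/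
theorem ip_nproj_nproj {x : ℝ × ℝ → V4} {p : ℝ × ℝ} (hE : Ef x p ≠ 0)
    (hYY : ip (pv x p) (pv x p) = -Ef x p) (hXY : ip (pu x p) (pv x p) = 0) (w z : V4) :
    ip (nproj x w p) (nproj x z p) = ip w z - ip w (pu x p) * ip z (pu x p) / Ef x p +
      ip w (pv x p) * ip z (pv x p) / Ef x p := by
  have hXX : ip (pu x p) (pu x p) = Ef x p := rfl
  simp only [nproj, ip_add_left, ip_add_right, ip_sub_left, ip_sub_right, ip_smul_left,
    ip_smul_right, hXX, hYY, hXY, ip_comm (pv x p) (pu x p), ip_comm (pu x p) z,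
    ip_comm (pv x p) z]
  field_simp
  ring

theorem ip_pu_nproj {x : ℝ × ℝ → V4} {p : ℝ × ℝ} (hE : Ef x p ≠ 0)
    (hXY : ip (pu x p) (pv x p) = 0) (w : V4) : ip (pu x p) (nproj x w p) = 0 := by
  have hXX : ip (pu x p) (pu x p) = Ef x p := rfl
  simp only [nproj, ip_add_right, ip_sub_right, ip_smul_right, hXX, hXY, ip_comm (pu x p) w]
  field_simp
  ring

theorem ip_pv_nproj {x : ℝ × ℝ → V4} {p : ℝ × ℝ} (hE : Ef x p ≠ 0)
    (hYY : ip (pv x p) (pv x p) = -Ef x p) (hXY : ip (pu x p) (pv x p) = 0) (w : V4) :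
    ip (pv x p) (nproj x w p) = 0 := by
  simp only [nproj, ip_add_right, ip_sub_right, ip_smul_right, hYY, ip_comm (pv x p) (pu x p),
    hXY, ip_comm (pv x p) w]
  field_simp
  ring

/-- The vectors `x_u, x_v, x_uu, x_uv` along a surface. -/
def frame (x : ℝ × ℝ → V4) (i : Fin 4) (p : ℝ × ℝ) : V4 :=
  ![pu x p, pv x p, pu (pu x) p, pv (pu x) p] i

theorem ContDiffOn.frame {x : ℝ × ℝ → V4} (hx : ContDiffOn ℝ (⊤ : ℕ∞) x U) (hU : IsOpen U)
    (i : Fin 4) : ContDiffOn ℝ (⊤ : ℕ∞) (frame x i) U := by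
  fin_cases i
  exacts [hx.pu hU, hx.pv hU, (hx.pu hU).pu hU, (hx.pu hU).pv hU]

theorem GoodSurf.mono {x : ℝ × ℝ → V4} {V : Set (ℝ × ℝ)} (hx : GoodSurf U x) (h : V ⊆ U) :
    GoodSurf V x :=
  ⟨hx.1.mono h, fun p hp => hx.2.1 p (h hp), fun p hp => hx.2.2.1 p (h hp),
    fun p hp => hx.2.2.2 p (h hp)⟩

/-- The second fundamental form of a surface in canonical coordinates in terms of `E` and `K`. -/
theorem GoodSurf.ip_sff {x : ℝ × ℝ → V4} (hx : GoodSurf U x) {p : ℝ × ℝ} (hp : p ∈ U) :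
    ip (sffA x p) (sffA x p) = -GaussK x p * Ef x p ^ 2 / 2 ∧
      ip (sffB x p) (sffB x p) = GaussK x p * Ef x p ^ 2 / 2 ∧
      ip (sffA x p) (sffB x p) = 1 / 2 := by
  obtain ⟨-, hI, -, hC⟩ := hx
  obtain ⟨h1, h2⟩ := hC p hp
  have hE : Ef x p ^ 2 ≠ 0 := pow_ne_zero 2 (hI p hp).1.ne
  have h3 : GaussK x p * Ef x p ^ 2 =
      ip (sffB x p) (sffB x p) - ip (sffA x p) (sffA x p) := div_mul_cancel₀ _ hE
  refine ⟨?_, ?_, ?_⟩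
  · linear_combination h1 / 2 + h3 / 2
  · linear_combination h1 / 2 - h3 / 2
  · linear_combination h2 / 2

theorem GoodSurf.det4_frame {x : ℝ × ℝ → V4} (hx : GoodSurf U x) {p : ℝ × ℝ} (hp : p ∈ U) :
    det4 (pu x p) (pv x p) (pu (pu x) p) (pv (pu x) p) = -NormK x p * Ef x p ^ 3 / 2 := by
  have hE : Ef x p ^ 3 ≠ 0 := pow_ne_zero 3 (hx.2.1 p hp).1.ne
  have h : NormK x p * Ef x p ^ 3 =
      -2 * det4 (pu x p) (pv x p) (sffA x p) (sffB x p) := div_mul_cancel₀ _ hE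
  rw [sffA, sffB, nproj, nproj, det4_normal] at h
  linear_combination h / 2

/-- The coefficient `E` is determined by the curvatures. -/
theorem GoodSurf.sq_sub_sq_mul_Ef {x : ℝ × ℝ → V4} (hx : GoodSurf U x) {p : ℝ × ℝ} (hp : p ∈ U) :
    (NormK x p ^ 2 - GaussK x p ^ 2) * Ef x p ^ 4 = 1 := by
  obtain ⟨hE, hYY, hXY⟩ := hx.2.1 p hp
  have hE2 : Ef x p ^ 2 ≠ 0 := pow_ne_zero 2 hE.ne
  obtain ⟨haa, hbb, hab⟩ := hx.ip_sff hp
  have h := det4_sq_of_orthogonal (P := pu x p) (Q := pv x p) (N := sffA x p) (M := sffB x p) rfl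
    hYY hXY (ip_pu_nproj hE.ne hXY _) (ip_pu_nproj hE.ne hXY _) (ip_pv_nproj hE.ne hYY hXY _)
    (ip_pv_nproj hE.ne hYY hXY _)
  have hdet : det4 (pu x p) (pv x p) (sffA x p) (sffB x p) = -NormK x p * Ef x p ^ 3 / 2 := by
    rw [sffA, sffB, nproj, nproj, det4_normal, hx.det4_frame hp]
  rw [hdet, haa, hbb, hab, ← Ef] at h
  refine mul_left_cancel₀ hE2 ?_
  linear_combination 4 * h

theorem GoodSurf.Ef_eq {x y : ℝ × ℝ → V4} (hx : GoodSurf U x) (hy : GoodSurf U y) {p : ℝ × ℝ}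
    (hp : p ∈ U) (hK : GaussK x p = GaussK y p) (hκ : NormK x p = NormK y p) :
    Ef x p = Ef y p := by
  have h1 := hx.sq_sub_sq_mul_Ef hp
  have h2 := hy.sq_sub_sq_mul_Ef hp
  rw [hK, hκ] at h1
  have hne : NormK y p ^ 2 - GaussK y p ^ 2 ≠ 0 := left_ne_zero_of_mul_eq_one h2
  have h3 : (-Ef x p) ^ 4 = (-Ef y p) ^ 4 := by
    rw [Even.neg_pow (by decide), Even.neg_pow (by decide)]
    exact mul_left_cancel₀ hne (h1.trans h2.symm)
  exact neg_injective ((pow_left_inj₀ (neg_nonneg.2 (hx.2.1 p hp).1.le)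
    (neg_nonneg.2 (hy.2.1 p hp).1.le) (by norm_num)).1 h3)

/-- The Gram matrix of the frame in terms of `E` and `K`. -/
theorem GoodSurf.ip_frame {x : ℝ × ℝ → V4} (hx : GoodSurf U x) (hU : IsOpen U) {p : ℝ × ℝ}
    (hp : p ∈ U) (i j : Fin 4) :
    ip (frame x i p) (frame x j p) =
      !![Ef x p, 0, pu (Ef x) p / 2, pv (Ef x) p / 2;
        0, -Ef x p, -pv (Ef x) p / 2, -pu (Ef x) p / 2;
        pu (Ef x) p / 2, -pv (Ef x) p / 2,
          -GaussK x p * Ef x p ^ 2 / 2 + (pu (Ef x) p ^ 2 - pv (Ef x) p ^ 2) / (4 * Ef x p), 1 / 2;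
        pv (Ef x) p / 2, -pu (Ef x) p / 2, 1 / 2,
          GaussK x p * Ef x p ^ 2 / 2 +
            (pv (Ef x) p ^ 2 - pu (Ef x) p ^ 2) / (4 * Ef x p)] i j := by
  have hs := hx.1
  obtain ⟨hE, hYY, hXY⟩ := hx.2.1 p hp
  obtain ⟨haa, hbb, hab⟩ := hx.ip_sff hp
  have hE0 := hE.ne
  have hXX : ip (pu x p) (pu x p) = Ef x p := rfl
  have hYu : pu (pv x) p = pv (pu x) p := pu_pv_eq_pv_pu hs hU hp
  have hXu : pu (Ef x) p = 2 * ip (pu (pu x) p) (pu x p) :=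
    (pu_ip hU (hs.pu hU) (hs.pu hU) hp).trans (by rw [ip_comm (pu x p)]; ring)
  have hXv : pv (Ef x) p = 2 * ip (pv (pu x) p) (pu x p) :=
    (pv_ip hU (hs.pu hU) (hs.pu hU) hp).trans (by rw [ip_comm (pu x p)]; ring)
  have hneg : pu (fun q => -Ef x q) p = -pu (Ef x) p := by
    simp only [pu, fderiv_fun_neg]; rfl
  have hYu' : -pu (Ef x) p = 2 * ip (pv (pu x) p) (pv x p) := by
    rw [← hneg, ← pu_congr hU (fun q hq => (hx.2.1 q hq).2.1) hp, pu_ip hU (hs.pv hU) (hs.pv hU) hp,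
      hYu, ip_comm (pv x p)]
    ring
  have hXYu : 0 = ip (pu (pu x) p) (pv x p) + ip (pv (pu x) p) (pu x p) := by
    have h := pu_ip hU (hs.pu hU) (hs.pv hU) hp
    rw [pu_congr hU (fun q hq => (hx.2.1 q hq).2.2) hp, hYu, ip_comm (pu x p)] at h
    simpa [pu] using h
  have e1 : ip (pu (pu x) p) (pu x p) = pu (Ef x) p / 2 := by linear_combination -hXu / 2
  have e2 : ip (pv (pu x) p) (pu x p) = pv (Ef x) p / 2 := by linear_combination -hXv / 2
  have e3 : ip (pv (pu x) p) (pv x p) = -pu (Ef x) p / 2 := by linear_combination -hYu' / 2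
  have e4 : ip (pu (pu x) p) (pv x p) = -pv (Ef x) p / 2 := by linear_combination -hXYu - e2
  rw [sffA, ip_nproj_nproj hE0 hYY hXY, e1, e4] at haa
  rw [sffB, ip_nproj_nproj hE0 hYY hXY, e2, e3] at hbb
  rw [sffA, sffB, ip_nproj_nproj hE0 hYY hXY, e1, e2, e3, e4] at hab
  have e5 : ip (pu (pu x) p) (pu (pu x) p) = -GaussK x p * Ef x p ^ 2 / 2 +
      (pu (Ef x) p ^ 2 - pv (Ef x) p ^ 2) / (4 * Ef x p) := by
    rw [← haa]; field_simp; ring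
  have e6 : ip (pv (pu x) p) (pv (pu x) p) = GaussK x p * Ef x p ^ 2 / 2 +
      (pv (Ef x) p ^ 2 - pu (Ef x) p ^ 2) / (4 * Ef x p) := by
    rw [← hbb]; field_simp; ring
  have e7 : ip (pu (pu x) p) (pv (pu x) p) = 1 / 2 := by
    rw [← hab]; field_simp; ring
  fin_cases i <;> fin_cases j <;> simp only [frame]
  exacts [hXX, hXY, (ip_comm _ _).trans e1, (ip_comm _ _).trans e2,
    (ip_comm _ _).trans hXY, hYY, (ip_comm _ _).trans e4, (ip_comm _ _).trans e3,
    e1, e4, e5, e7, e2, e3, (ip_comm _ _).trans e7, e6]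

theorem GoodSurf.ip_frame_eq {x y : ℝ × ℝ → V4} (hx : GoodSurf U x) (hy : GoodSurf U y)
    (hU : IsOpen U) (hK : ∀ p ∈ U, GaussK x p = GaussK y p)
    (hκ : ∀ p ∈ U, NormK x p = NormK y p) {p : ℝ × ℝ} (hp : p ∈ U) (i j : Fin 4) :
    ip (frame x i p) (frame x j p) = ip (frame y i p) (frame y j p) := by
  have hE : ∀ p ∈ U, Ef x p = Ef y p := fun p hp => hx.Ef_eq hy hp (hK p hp) (hκ p hp)
  rw [hx.ip_frame hU hp, hy.ip_frame hU hp, hE p hp, pu_congr hU hE hp, pv_congr hU hE hp, hK p hp]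

/-- The scalar products of the derivatives of the frame with the frame, in terms of the Gram
matrix. -/
theorem GoodSurf.ip_pu_frame {x : ℝ × ℝ → V4} (hx : GoodSurf U x) (hU : IsOpen U) {p : ℝ × ℝ}
    (hp : p ∈ U) {g : Fin 4 → Fin 4 → ℝ × ℝ → ℝ}
    (hg : ∀ i j, ∀ q ∈ U, ip (frame x i q) (frame x j q) = g i j q) (i j : Fin 4) :
    ip (pu (frame x i) p) (frame x j p) =
      !![g 2 0 p, g 2 1 p, g 2 2 p, g 2 3 p;
        g 3 0 p, g 3 1 p, g 3 2 p, g 3 3 p;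
        pu (g 2 0) p - g 2 2 p, pu (g 2 1) p - g 2 3 p, pu (g 2 2) p / 2,
          pu (g 2 3) p - pv (g 2 2) p / 2;
        pu (g 3 0) p - g 3 2 p, pu (g 3 1) p - g 3 3 p, pv (g 2 2) p / 2, pu (g 3 3) p / 2] i j ∧
    ip (pv (frame x i) p) (frame x j p) =
      !![g 3 0 p, g 3 1 p, g 3 2 p, g 3 3 p;
        g 2 0 p, g 2 1 p, g 2 2 p, g 2 3 p;
        pu (g 3 0) p - g 3 2 p, pu (g 3 1) p - g 3 3 p, pv (g 2 2) p / 2, pu (g 3 3) p / 2;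
        pu (g 2 0) p - g 2 2 p, pu (g 2 1) p - g 2 3 p, pu (g 2 2) p / 2,
          pu (g 2 3) p - pv (g 2 2) p / 2] i j := by
  have hs := hx.1
  have hF := fun i => hs.frame hU i
  have hm : ∀ q ∈ U, pv (pv x) q = pu (pu x) q := fun q hq => (sub_eq_zero.1 (hx.2.2.1 q hq)).symm
  have d00 : pu (frame x 0) p = frame x 2 p := rfl
  have d01 : pv (frame x 0) p = frame x 3 p := rfl
  have d10 : pu (frame x 1) p = frame x 3 p := pu_pv_eq_pv_pu hs hU hp
  have d11 : pv (frame x 1) p = frame x 2 p := hm p hp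
  have d21 : pv (frame x 2) p = pu (frame x 3) p := (pu_pv_eq_pv_pu (hs.pu hU) hU hp).symm
  have d31 : pv (frame x 3) p = pu (frame x 2) p :=
    calc pv (pv (pu x)) p = pv (pu (pv x)) p :=
          pv_congr hU (fun q hq => (pu_pv_eq_pv_pu hs hU hq).symm) hp
      _ = pu (pv (pv x)) p := (pu_pv_eq_pv_pu (hs.pv hU) hU hp).symm
      _ = pu (pu (pu x)) p := pu_congr hU hm hp
  have Gu : ∀ i j, pu (g i j) p =
      ip (pu (frame x i) p) (frame x j p) + ip (frame x i p) (pu (frame x j) p) := fun i j => by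
    rw [← pu_ip hU (hF i) (hF j) hp, pu_congr hU (hg i j) hp]
  have Gv : ∀ i j, pv (g i j) p =
      ip (pv (frame x i) p) (frame x j p) + ip (frame x i p) (pv (frame x j) p) := fun i j => by
    rw [← pv_ip hU (hF i) (hF j) hp, pv_congr hU (hg i j) hp]
  have c := fun i j => hg i j p hp
  have s0 : ip (pu (frame x 2) p) (frame x 0 p) = pu (g 2 0) p - g 2 2 p := by
    rw [Gu, d00, ← c]; ring
  have s1 : ip (pu (frame x 2) p) (frame x 1 p) = pu (g 2 1) p - g 2 3 p := by
    rw [Gu, d10, ← c]; ring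
  have s2 : ip (pu (frame x 2) p) (frame x 2 p) = pu (g 2 2) p / 2 := by
    rw [Gu, ip_comm (frame x 2 p)]; ring
  have t0 : ip (pu (frame x 3) p) (frame x 0 p) = pu (g 3 0) p - g 3 2 p := by
    rw [Gu, d00, ← c]; ring
  have t1 : ip (pu (frame x 3) p) (frame x 1 p) = pu (g 3 1) p - g 3 3 p := by
    rw [Gu, d10, ← c]; ring
  have t2 : ip (pu (frame x 3) p) (frame x 2 p) = pv (g 2 2) p / 2 := by
    rw [Gv, ip_comm (frame x 2 p), d21]; ring
  have t3 : ip (pu (frame x 3) p) (frame x 3 p) = pu (g 3 3) p / 2 := by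
    rw [Gu, ip_comm (frame x 3 p)]; ring
  have s3 : ip (pu (frame x 2) p) (frame x 3 p) = pu (g 2 3) p - pv (g 2 2) p / 2 := by
    rw [Gu, ← t2, ip_comm (frame x 2 p)]; ring
  constructor
  · fin_cases i
    · exact (congrArg (fun v => ip v (frame x j p)) d00).trans
        ((c 2 j).trans (by fin_cases j <;> rfl))
    · exact (congrArg (fun v => ip v (frame x j p)) d10).trans
        ((c 3 j).trans (by fin_cases j <;> rfl))
    · fin_cases j
      exacts [s0, s1, s2, s3]
    · fin_cases j
      exacts [t0, t1, t2, t3]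
  · fin_cases i
    · exact (congrArg (fun v => ip v (frame x j p)) d01).trans
        ((c 3 j).trans (by fin_cases j <;> rfl))
    · exact (congrArg (fun v => ip v (frame x j p)) d11).trans
        ((c 2 j).trans (by fin_cases j <;> rfl))
    · refine (congrArg (fun v => ip v (frame x j p)) d21).trans ?_
      fin_cases j
      exacts [t0, t1, t2, t3]
    · refine (congrArg (fun v => ip v (frame x j p)) d31).trans ?_
      fin_cases j
      exacts [s0, s1, s2, s3]

theorem fderiv_pi_apply {f : ℝ × ℝ → V4} {p : ℝ × ℝ} (hf : DifferentiableAt ℝ f p) (w : ℝ × ℝ)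
    (j : Fin 4) : fderiv ℝ (fun q => f q j) p w = fderiv ℝ f p w j := by
  rw [(hasFDerivAt_pi'.1 hf.hasFDerivAt j).fderiv]
  rfl

/-- A time-like minimal surface in canonical coordinates is determined by its curvatures up to a
proper motion. -/
theorem GoodSurf.exists_motion {x y : ℝ × ℝ → V4} (hx : GoodSurf U x) (hy : GoodSurf U y)
    (hU : IsOpen U) (hc : IsPreconnected U) (hne : U.Nonempty)
    (hK : ∀ p ∈ U, GaussK x p = GaussK y p) (hκ : ∀ p ∈ U, NormK x p = NormK y p)
    (hκ0 : ∀ p ∈ U, NormK y p ≠ 0) :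
    ∃ (A : V4 →ₗ[ℝ] V4) (c : V4), (∀ v w : V4, ip (A v) (A w) = ip v w) ∧ LinearMap.det A = 1 ∧
      ∀ p ∈ U, y p = A (x p) + c := by
  obtain ⟨t₀, ht₀⟩ := hne
  have hG : ∀ i j, ∀ p ∈ U, ip (frame x i p) (frame x j p) = ip (frame y i p) (frame y j p) :=
    fun i j p hp => hx.ip_frame_eq hy hU hK hκ hp i j
  set R : (ℝ × ℝ → V4) → ℝ × ℝ → Matrix (Fin 4) (Fin 4) ℝ :=
    fun z p => Matrix.of fun i => frame z i p with hR
  have hdet : ∀ z, GoodSurf U z → ∀ p ∈ U, (R z p).det = -NormK z p * Ef z p ^ 3 / 2 :=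
    fun z hz p hp => by
      rw [← hz.det4_frame hp, det4, Matrix.det_transpose]
      rfl
  have hdy : ∀ p ∈ U, (R y p).det ≠ 0 := fun p hp => by
    rw [hdet y hy p hp]
    exact div_ne_zero (mul_ne_zero (neg_ne_zero.2 (hκ0 p hp))
      (pow_ne_zero 3 (hy.2.1 p hp).1.ne)) two_ne_zero
  have hdxy : ∀ p ∈ U, (R x p).det = (R y p).det := fun p hp => by
    rw [hdet y hy p hp, hdet x hx p hp, hκ p hp, hx.Ef_eq hy hp (hK p hp) (hκ p hp)]
  have hdx : ∀ p ∈ U, (R x p).det ≠ 0 := fun p hp => by rw [hdxy p hp]; exact hdy p hp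
  have hsR : ∀ z, GoodSurf U z → ∀ i j, ContDiffOn ℝ 1 (fun p => R z p i j) U :=
    fun z hz i j => (contDiffOn_pi.1 (hz.1.frame hU i) j).of_le (by exact_mod_cast le_top)
  set B : ℝ × ℝ → Matrix (Fin 4) (Fin 4) ℝ := fun p => (R x p)⁻¹ * R y p with hB
  have hsB : ∀ i j, ∀ p ∈ U, DifferentiableAt ℝ (fun p => B p i j) p := fun i j p hp => by
    have : ContDiffOn ℝ 1 (fun p => B p i j) U := by
      simp only [hB, Matrix.mul_apply]
      exact ContDiffOn.sum fun k _ =>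
        (contDiffOn_inv_apply (n := 1) (hsR x hx) hdx i k).mul (hsR y hy k j)
    exact (this.differentiableOn one_ne_zero).differentiableAt (hU.mem_nhds hp)
  have hRB : ∀ p ∈ U, R x p * B p = R y p := fun p hp => by
    rw [hB, ← mul_assoc, Matrix.mul_nonsing_inv _ (isUnit_iff_ne_zero.2 (hdx p hp)), one_mul]
  have hGR : ∀ p ∈ U, R x p * ipMatrix * (R x p).transpose =
      R y p * ipMatrix * (R y p).transpose := fun p hp => by
    ext i j
    rw [mul_ipMatrix_mul_transpose_apply, mul_ipMatrix_mul_transpose_apply, hG i j p hp]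
  have hdR : ∀ z, GoodSurf U z → ∀ p ∈ U, ∀ w i j, fderiv ℝ (fun p => R z p i j) p w =
      Matrix.of (fun i => fderiv ℝ (frame z i) p w) i j := fun z hz p hp w i j =>
    fderiv_pi_apply ((hz.1.frame hU i).differentiableAt_of_isOpen hU hp) w j
  have hB0 : ∀ p ∈ U, ∀ i j, pu (fun p => B p i j) p = 0 ∧ pv (fun p => B p i j) p = 0 := by
    intro p hp i j
    have key := fun w => fderiv_transition_eq_zero (w := w) hU
      (fun i j p hp => ((hsR x hx i j).differentiableOn one_ne_zero).differentiableAt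
        (hU.mem_nhds hp)) hsB hRB hp (hdx p hp) (hdy p hp) (hGR p hp)
      (hdR x hx p hp w) (hdR y hy p hp w)
    have hx' := hx.ip_pu_frame hU hp hG
    have hy' := hy.ip_pu_frame hU hp (fun i j q _ => rfl)
    constructor
    · refine key (1, 0) ?_ i j
      ext i j
      rw [mul_ipMatrix_mul_transpose_apply, mul_ipMatrix_mul_transpose_apply]
      exact (hx' i j).1.trans (hy' i j).1.symm
    · refine key (0, 1) ?_ i j
      ext i j
      rw [mul_ipMatrix_mul_transpose_apply, mul_ipMatrix_mul_transpose_apply]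
      exact (hx' i j).2.trans (hy' i j).2.symm
  have hBc : ∀ p ∈ U, B p = B t₀ := fun p hp => by
    ext i j
    exact eq_of_pu_pv_eq_zero hU hc (hsB i j) (fun p hp => (hB0 p hp i j).1)
      (fun p hp => (hB0 p hp i j).2) hp ht₀
  have hBη : B t₀ * ipMatrix * (B t₀).transpose = ipMatrix := by
    have u : IsUnit (R x t₀) := (Matrix.isUnit_iff_isUnit_det _).2
      (isUnit_iff_ne_zero.2 (hdx t₀ ht₀))
    have u' : IsUnit (R x t₀).transpose := (Matrix.isUnit_iff_isUnit_det _).2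
      (by rw [Matrix.det_transpose]; exact isUnit_iff_ne_zero.2 (hdx t₀ ht₀))
    refine u.mul_left_cancel (u'.mul_right_cancel ?_)
    clear_value B
    rw [hGR t₀ ht₀, ← hRB t₀ ht₀, Matrix.transpose_mul]
    simp only [mul_assoc]
  have hrow : ∀ p ∈ U, ∀ i, frame y i p = (B t₀).transpose.mulVec (frame x i p) :=
    fun p hp i => by
      have := congrFun (hRB p hp) i
      rw [hBc p hp] at this
      rw [Matrix.mulVec_transpose]
      exact this.symm
  set A : V4 →ₗ[ℝ] V4 := Matrix.toLin' (B t₀).transpose with hA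
  have hdiff : ∀ p ∈ U, ∀ w, fderiv ℝ (fun q => y q - A (x q)) p w =
      fderiv ℝ y p w - A (fderiv ℝ x p w) := fun p hp w => by
    have h := (hy.1.differentiableAt_of_isOpen hU hp).hasFDerivAt.sub
      ((LinearMap.toContinuousLinearMap A).hasFDerivAt.comp p
        (hx.1.differentiableAt_of_isOpen hU hp).hasFDerivAt)
    exact congrArg (fun L : ℝ × ℝ →L[ℝ] V4 => L w) h.fderiv
  refine ⟨A, y t₀ - A (x t₀), fun v w => ?_, ?_, fun p hp => ?_⟩
  · rw [ip_eq_mulVec, ip_eq_mulVec, hA, Matrix.toLin'_apply, Matrix.toLin'_apply,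
      Matrix.mulVec_mulVec, Matrix.mulVec_transpose, ← Matrix.dotProduct_mulVec,
      Matrix.mulVec_mulVec, ← mul_assoc, hBη]
  · have h := congrArg Matrix.det (hRB t₀ ht₀)
    rw [Matrix.det_mul, hdxy t₀ ht₀] at h
    rw [hA, LinearMap.det_toLin', Matrix.det_transpose]
    exact mul_left_cancel₀ (hdy t₀ ht₀) (h.trans (mul_one _).symm)
  · have h := eq_of_pu_pv_eq_zero (f := fun q => y q - A (x q)) hU hc
      (fun q hq => (hy.1.differentiableAt_of_isOpen hU hq).sub
        ((LinearMap.toContinuousLinearMap A).differentiableAt.comp q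
          (hx.1.differentiableAt_of_isOpen hU hq)))
      (fun q hq => (hdiff q hq _).trans (sub_eq_zero.2 (hrow q hq 0)))
      (fun q hq => (hdiff q hq _).trans (sub_eq_zero.2 (hrow q hq 1))) hp ht₀
    rw [← h, add_sub_cancel]

end Uniqueness

/-- Bonnet-type theorem, third type. Any solution (K, ϰ) of the system of
natural equations with K p ^ 2 - κ p ^ 2 < 0 is locally realized by a unique (up to a proper motion of
ℝ⁴₂) minimal time-like surface of the third type in canonical coordinates. -/
theorem stmt_16 (D : Set (ℝ × ℝ)) (hD : IsOpen D) (K κ : ℝ × ℝ → ℝ)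
    (hK : ContDiffOn ℝ (⊤ : ℕ∞) K D) (hκ : ContDiffOn ℝ (⊤ : ℕ∞) κ D)
    (hsign : ∀ p ∈ D, K p ^ 2 - κ p ^ 2 < 0)
    (heq1 : ∀ p ∈ D, |K p ^ 2 - κ p ^ 2| ^ ((1 : ℝ) / 4) *
      hlap (fun s => Real.log |K s ^ 2 - κ s ^ 2|) p = -8 * K p)
    (heq2 : ∀ p ∈ D, |K p ^ 2 - κ p ^ 2| ^ ((1 : ℝ) / 4) *
      hlap (fun s => Real.log |(K s + κ s) / (K s - κ s)|) p = -4 * κ p) :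
    ∀ t₀ ∈ D,
      (∃ D₀ : Set (ℝ × ℝ), IsOpen D₀ ∧ t₀ ∈ D₀ ∧ D₀ ⊆ D ∧
        ∃ x : ℝ × ℝ → V4, GoodSurf D₀ x ∧
          ∀ p ∈ D₀, GaussK x p = K p ∧ NormK x p = κ p) ∧
      (∀ (D₁ D₂ : Set (ℝ × ℝ)) (x₁ x₂ : ℝ × ℝ → V4),
        IsOpen D₁ → t₀ ∈ D₁ → D₁ ⊆ D → GoodSurf D₁ x₁ →
        (∀ p ∈ D₁, GaussK x₁ p = K p ∧ NormK x₁ p = κ p) →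
        IsOpen D₂ → t₀ ∈ D₂ → D₂ ⊆ D → GoodSurf D₂ x₂ →
        (∀ p ∈ D₂, GaussK x₂ p = K p ∧ NormK x₂ p = κ p) →
        ∃ (D₃ : Set (ℝ × ℝ)) (A : V4 →ₗ[ℝ] V4) (c : V4),
          IsOpen D₃ ∧ t₀ ∈ D₃ ∧ D₃ ⊆ D₁ ∩ D₂ ∧
          (∀ v w : V4, ip (A v) (A w) = ip v w) ∧ LinearMap.det A = 1 ∧
          ∀ p ∈ D₃, x₂ p = A (x₁ p) + c) := by
  intro t₀ ht₀
  have hκ0 : ∀ p ∈ D, κ p ≠ 0 := fun p hp h0 => by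
    have := hsign p hp
    rw [h0] at this
    nlinarith [sq_nonneg (K p)]
  refine ⟨?_, fun D₁ D₂ x₁ x₂ hD₁ ht₁ hDD₁ hx₁ hc₁ hD₂ ht₂ _ hx₂ hc₂ => ?_⟩
  · obtain ⟨σ, hσ, hσκ⟩ : ∃ σ : ℝ, σ ^ 2 = 1 ∧ σ * κ t₀ < 0 := by
      rcases (hκ0 t₀ ht₀).lt_or_gt with h | h
      · exact ⟨1, by norm_num, by linarith⟩
      · exact ⟨-1, by norm_num, by linarith⟩
    set D' : Set (ℝ × ℝ) := D ∩ (fun p => σ * κ p) ⁻¹' Iio 0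
    have hsub : D' ⊆ D := inter_subset_left
    have hD' : IsOpen D' :=
      (continuousOn_const.mul hκ.continuousOn).isOpen_inter_preimage hD isOpen_Iio
    obtain ⟨D₀, h₁, h₂, h₃, h₄⟩ := exists_surface_of_natural_equations hD' hσ (hK.mono hsub)
      (hκ.mono hsub) (fun p hp => hsign p (hsub hp)) (fun p hp => hp.2)
      (fun p hp => heq1 p (hsub hp)) (fun p hp => heq2 p (hsub hp)) ⟨ht₀, hσκ⟩
    exact ⟨D₀, h₁, h₂, h₃.trans hsub, h₄⟩
  · obtain ⟨r, hr, hball⟩ := Metric.isOpen_iff.1 (hD₁.inter hD₂) t₀ ⟨ht₁, ht₂⟩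
    have h₁ : ball t₀ r ⊆ D₁ := hball.trans inter_subset_left
    have h₂ : ball t₀ r ⊆ D₂ := hball.trans inter_subset_right
    obtain ⟨A, c, hA, hdet, hAc⟩ := (hx₁.mono h₁).exists_motion (hx₂.mono h₂) isOpen_ball
      (convex_ball t₀ r).isPreconnected ⟨t₀, mem_ball_self hr⟩
      (fun p hp => (hc₁ p (h₁ hp)).1.trans (hc₂ p (h₂ hp)).1.symm)
      (fun p hp => (hc₁ p (h₁ hp)).2.trans (hc₂ p (h₂ hp)).2.symm)
      (fun p hp => by rw [(hc₂ p (h₂ hp)).2]; exact hκ0 p (hDD₁ (h₁ hp)))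
    exact ⟨ball t₀ r, A, c, isOpen_ball, mem_ball_self hr, hball, hA, hdet, hAc⟩
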